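/- arXiv:1401.1865 — 3 statements merged into one kernel-verified Lean document; each statement's English description precedes it below -/
import Mathlib

section
/- For every prime power q = p^k (p prime, k ≥ 1 an integer), there exists a (q+1)-regular bipartite simple graph G, namely the point–line incidence graph of the projective plane PG(2,q), whose HL-index equals √q. Consequently sup{R(G) : Δ(G) ≤ q+1} ≥ √q, i.e. R(d) ≥ √(d−1) for d = q+1. -/
open Polynomial in
/-- The adjacency matrix of the bipartite double of a relation with matrix `M`. -/
theorem hl_charpoly_blocks {P : Type*} [Fintype P] [DecidableEq P] (q N : ℕ)
    (hN : N = q ^ 2 + q) (hcard : Fintype.card P = N + 1)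
    (M : Matrix P P ℝ)
    (hM : M * M = (q : ℝ) • (1 : Matrix P P ℝ) + Matrix.vecMulVec (fun _ => 1) (fun _ => 1)) :
    (Matrix.fromBlocks 0 M M 0).charpoly =
      (X - C ((q : ℝ) + 1)) * (X - C (Real.sqrt q)) ^ N * (X - C (-Real.sqrt q)) ^ N *
        (X - C (-((q : ℝ) + 1))) := by
  apply eq_of_infinite_eval_eq
  refine Set.Infinite.mono ?_ (Set.Ioi_infinite (0 : ℝ))
  intro t ht
  have ht0 : t ≠ 0 := ne_of_gt ht
  simp only [Set.mem_ofPred_eq]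
  rw [Matrix.eval_charpoly]
  have h1 : (Matrix.scalar (P ⊕ P) t - Matrix.fromBlocks 0 M M 0) =
      Matrix.fromBlocks (t • 1) (-M) (-M) (t • 1) := by
    rw [Matrix.scalar_apply, ← Matrix.smul_one_eq_diagonal, ← Matrix.fromBlocks_one,
      Matrix.fromBlocks_smul, sub_eq_add_neg, Matrix.fromBlocks_neg, Matrix.fromBlocks_add]
    simp
  have h2 : Matrix.fromBlocks (t • 1) (-M) (-M) (t • 1) * Matrix.fromBlocks (t • 1) 0 M 1 =
      Matrix.fromBlocks (Matrix.scalar P (t ^ 2 - q) - Matrix.vecMulVec (fun _ => 1) (fun _ => 1))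
        (-M) 0 (t • 1) := by
    rw [Matrix.fromBlocks_multiply]
    congr 1
    · rw [Matrix.neg_mul, hM, Matrix.scalar_apply, ← Matrix.smul_one_eq_diagonal, sub_smul]
      simp only [Matrix.smul_mul, Matrix.one_mul, smul_smul, pow_two]
      abel
    · simp
    · simp
    · simp
  have h3 := congrArg Matrix.det h2
  rw [Matrix.det_mul, Matrix.det_fromBlocks_zero₂₁, Matrix.det_fromBlocks_zero₁₂, Matrix.det_one,
    mul_one, Matrix.det_smul, Matrix.det_one, mul_one, ← Matrix.eval_charpoly,
    Matrix.charpoly_vecMulVec] at h3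
  have h4 := mul_right_cancel₀ (pow_ne_zero _ ht0) h3
  rw [h1, h4, hcard]
  have hs : Real.sqrt q ^ 2 = q := Real.sq_sqrt (Nat.cast_nonneg q)
  have hd : ((fun _ => 1 : P → ℝ) ⬝ᵥ (fun _ => 1)) = (q : ℝ) ^ 2 + q + 1 := by
    simp [dotProduct, hcard, hN]
  rw [hd]
  have e : t ^ 2 - (q : ℝ) = (t - Real.sqrt q) * (t + Real.sqrt q) := by
    rw [← sub_eq_zero]; ring_nf; rw [hs]; ring
  simp only [eval_sub, eval_pow, eval_X, eval_smul, eval_mul, eval_C, Nat.add_sub_cancel,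
    smul_eq_mul, sub_neg_eq_add]
  rw [pow_succ]
  calc _ = (t ^ 2 - (q : ℝ)) ^ N * ((t - (q + 1)) * (t + (q + 1))) := by ring
    _ = _ := by rw [e, mul_pow]; ring

open Polynomial in
theorem hl_mid_eigs (q N n : ℕ) (hq : 1 ≤ q) (hn : n = 2 * (N + 1)) (hN : 1 ≤ N) (μ : Fin n → ℝ)
    (hμ : Antitone μ)
    (h : (X - C ((q : ℝ) + 1)) * (X - C (Real.sqrt q)) ^ N * (X - C (-Real.sqrt q)) ^ N *
        (X - C (-((q : ℝ) + 1))) = ∏ i, (X - C (μ i))) (H L : Fin n)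
    (hH : (H : ℕ) = (n - 1) / 2) (hL : (L : ℕ) = n / 2) :
    max |μ H| |μ L| = Real.sqrt q := by
  set s := Real.sqrt q with hs
  have hs0 : 0 ≤ s := Real.sqrt_nonneg _
  have hsq : s ≤ q + 1 := by
    rw [hs, Real.sqrt_le_left (by positivity)]
    have : (0 : ℝ) ≤ q := Nat.cast_nonneg q
    nlinarith
  let l : List ℝ := [(q : ℝ) + 1] ++ List.replicate N s ++ List.replicate N (-s) ++ [-((q : ℝ) + 1)]
  have hl : l.SortedGE := by
    rw [List.sortedGE_iff_pairwise]
    simp only [l, List.pairwise_append, List.pairwise_replicate, List.mem_append,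
      List.mem_singleton, List.mem_replicate, List.pairwise_singleton]
    refine ⟨⟨⟨trivial, ?_, ?_⟩, ?_, ?_⟩, trivial, ?_⟩
    · right; exact le_rfl
    · rintro a rfl b ⟨-, rfl⟩; exact hsq
    · right; exact le_rfl
    · rintro a (rfl | ⟨-, rfl⟩) b ⟨-, rfl⟩ <;> simp only [ge_iff_le] <;> linarith
    · rintro a ((rfl | ⟨-, rfl⟩) | ⟨-, rfl⟩) b rfl <;> simp only [ge_iff_le] <;> linarith
  have hperm : (List.ofFn μ).Perm l := by
    rw [← Multiset.coe_eq_coe]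
    have e1 : (((List.ofFn μ : Multiset ℝ)).map (fun a => X - C a)).prod =
        ∏ i, (X - C (μ i)) := by
      rw [Multiset.map_coe, Multiset.prod_coe, List.map_ofFn, List.prod_ofFn]; rfl
    have e2 : (((l : Multiset ℝ)).map (fun a => X - C a)).prod =
        ∏ i, (X - C (μ i)) := by
      rw [← h]
      simp [l, mul_assoc]
    rw [← roots_multiset_prod_X_sub_C (List.ofFn μ : Multiset ℝ), e1, ← e2,
      roots_multiset_prod_X_sub_C]
  have heq : List.ofFn μ = l := List.Perm.eq_of_sortedGE hμ.sortedGE_ofFn hl hperm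
  have key : ∀ i : Fin n, some (μ i) = l[(i : ℕ)]? := by
    intro i; rw [← heq]; simp
  have h1 : μ H = s := by
    have := key H
    rw [show (H : ℕ) = N by omega] at this
    simp only [l] at this
    rw [List.getElem?_append_left (by simp), List.getElem?_append_left (by simp),
      List.getElem?_append_right (by simpa using hN), List.getElem?_replicate] at this
    simp at this
    exact this.2
  have h2 : μ L = -s := by
    have := key L
    rw [show (L : ℕ) = N + 1 by omega] at this
    simp only [l] at this
    rw [List.getElem?_append_left (by simp; omega),
      List.getElem?_append_right (by simp), List.getElem?_replicate] at this
    simp at this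
    grind
  rw [h1, h2, abs_neg, max_self, abs_of_nonneg hs0]

/-- The bipartite incidence graph of a symmetric relation. -/
def hlIncGraph {P : Type*} (r : P → P → Prop) (hr : ∀ a b, r a b → r b a) :
    SimpleGraph (P ⊕ P) where
  Adj x y := match x, y with
    | Sum.inl a, Sum.inr b => r a b
    | Sum.inr a, Sum.inl b => r a b
    | _, _ => False
  symm := ⟨by rintro (a | a) (b | b) h <;> first | exact hr _ _ h | exact h⟩
  loopless := ⟨by rintro (a | a) h <;> exact h⟩

open Classical in
/-- The polarity relation data of `PG(2,q)`. -/
theorem hl_exists_plane (p : ℕ) (hp : p.Prime) (k : ℕ) (hk : 1 ≤ k) (q : ℕ) (hq : q = p ^ k) :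
    ∃ (P : Type) (_ : Fintype P) (r : P → P → Prop), (∀ a b, r a b → r b a) ∧
      Fintype.card P = q ^ 2 + q + 1 ∧
      (∀ a, (Finset.univ.filter (fun b => r a b)).card = q + 1) ∧
      (∀ a b, a ≠ b → (Finset.univ.filter (fun c => r a c ∧ r c b)).card = 1) := by
  have : Fact p.Prime := ⟨hp⟩
  let K := GaloisField p k
  have : Finite K := inferInstance
  have hK : Nat.card K = q := by rw [hq]; exact GaloisField.card p k (by omega)
  let P := Projectivization K (Fin 3 → K)
  have : Finite P := inferInstance
  let : Fintype P := Fintype.ofFinite P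
  let : Configuration.ProjectivePlane P P :=
    inferInstanceAs (Configuration.ProjectivePlane (Projectivization K (Fin 3 → K))
      (Projectivization K (Fin 3 → K)))
  have hc : Fintype.card P = q ^ 2 + q + 1 := by
    rw [← Nat.card_eq_fintype_card, Projectivization.card_of_finrank K (Fin 3 → K) (n := 3) (by simp),
      hK]
    simp [Finset.sum_range_succ]; ring
  have ho : Configuration.ProjectivePlane.order P P = q := by
    have h := Configuration.ProjectivePlane.card_points P P
    rw [hc] at h
    rcases lt_trichotomy (Configuration.ProjectivePlane.order P P) q with h' | h' | h'
    · nlinarith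
    · exact h'
    · nlinarith
  refine ⟨P, inferInstance, fun a b => a.orthogonal b,
    fun a b h => Projectivization.orthogonal_comm.1 h, hc, ?_, ?_⟩
  · intro a
    have h := Configuration.ProjectivePlane.lineCount_eq (P := P) P a
    rw [ho, Configuration.lineCount, Nat.card_eq_fintype_card, Fintype.card_subtype] at h
    rw [← h]
    congr
  · intro a b hab
    rw [Finset.card_eq_one]
    refine ⟨Projectivization.cross a b, ?_⟩
    ext c
    simp only [Finset.mem_filter, Finset.mem_univ, true_and, Finset.mem_singleton]
    constructor
    · rintro ⟨h1, h2⟩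
      exact (Configuration.ofField.eq_or_eq_of_orthogonal h1 (Projectivization.orthogonal_comm.1 h2)
        (Projectivization.orthogonal_cross_left hab)
        (Projectivization.orthogonal_cross_right hab)).resolve_left hab
    · rintro rfl
      exact ⟨Projectivization.orthogonal_cross_left hab,
        Projectivization.orthogonal_comm.1 (Projectivization.orthogonal_cross_right hab)⟩

open Classical Polynomial in
theorem hl_exists_graph (p : ℕ) (hp : p.Prime) (k : ℕ) (hk : 1 ≤ k) (q : ℕ) (hq : q = p ^ k) :
    ∃ (n : ℕ) (G : SimpleGraph (Fin n)), n = 2 * (q ^ 2 + q + 1) ∧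
      (∀ v, G.degree v = q + 1) ∧ G.Colorable 2 ∧
      (G.adjMatrix ℝ).charpoly = (X - C ((q : ℝ) + 1)) * (X - C (Real.sqrt q)) ^ (q ^ 2 + q) *
        (X - C (-Real.sqrt q)) ^ (q ^ 2 + q) * (X - C (-((q : ℝ) + 1))) := by
  obtain ⟨P, _, r, hr, hc, hdeg, hpair⟩ := hl_exists_plane p hp k hk q hq
  let G₀ := hlIncGraph r hr
  let e : Fin (Fintype.card (P ⊕ P)) ≃ P ⊕ P := (Fintype.equivFin (P ⊕ P)).symm
  obtain ⟨G, hG⟩ : ∃ G : SimpleGraph (Fin (Fintype.card (P ⊕ P))),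
      ∀ a b, G.Adj a b ↔ G₀.Adj (e a) (e b) := ⟨G₀.comap e, fun a b => Iff.rfl⟩
  let iso : G ≃g G₀ := ⟨e, (hG _ _).symm⟩
  have hA : G₀.adjMatrix ℝ = Matrix.fromBlocks 0 (Matrix.of fun a b => if r a b then 1 else 0)
      (Matrix.of fun a b => if r a b then 1 else 0) 0 := by
    ext (a | a) (b | b) <;> simp [SimpleGraph.adjMatrix_apply, G₀, hlIncGraph]
  refine ⟨_, G, ?_, ?_, ?_, ?_⟩
  · rw [Fintype.card_sum, hc]; ring
  · intro v
    rw [← iso.degree_eq v]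
    generalize iso v = w
    have hw := SimpleGraph.degree_eq_sum_if_adj G₀ (R := ℕ) w
    rw [Nat.cast_id, Fintype.sum_sum_type] at hw
    rw [hw]
    rcases w with a | a <;> simp [G₀, hlIncGraph, hdeg]
  · refine SimpleGraph.Colorable.of_hom iso.toHom ?_
    refine ⟨SimpleGraph.Coloring.mk (fun x => Sum.elim (fun _ => 0) (fun _ => 1) x) ?_⟩
    rintro (a | a) (b | b) h <;> simp_all [G₀, hlIncGraph]
  · have : G.adjMatrix ℝ = Matrix.reindex e.symm e.symm (G₀.adjMatrix ℝ) := by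
      ext a b; simp [SimpleGraph.adjMatrix_apply, hG]
    rw [this, Matrix.charpoly_reindex, hA]
    refine hl_charpoly_blocks q _ rfl hc _ ?_
    ext a b
    simp only [Matrix.mul_apply, Matrix.of_apply, Matrix.add_apply, Matrix.smul_apply,
      Matrix.vecMulVec_apply, Matrix.one_apply, ← ite_and, mul_ite, mul_one, mul_zero, smul_eq_mul]
    by_cases hab : a = b
    · subst hab
      have : ∀ c, (r c a ∧ r a c) ↔ r a c := fun c => ⟨fun h => h.2, fun h => ⟨hr _ _ h, h⟩⟩
      simp [this, hdeg]
    · have := hpair a b hab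
      have h2 : ∀ c, (r c b ∧ r a c) ↔ (r a c ∧ r c b) := fun c => and_comm
      simp [hab, this, h2]


open Polynomial in
/-- `μ` is the sequence of adjacency eigenvalues of `G`, listed with multiplicity
in decreasing order (so `μ ⟨i-1,_⟩` is the `i`-th largest eigenvalue `λ_i`). -/
def SimpleGraph.IsEigenvalueSeq {V : Type*} [Fintype V] [DecidableEq V]
    (G : SimpleGraph V) (μ : Fin (Fintype.card V) → ℝ) : Prop :=
  Antitone μ ∧
    (letI : DecidableRel G.Adj := Classical.decRel _
     (SimpleGraph.adjMatrix ℝ G).charpoly) =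
      ∏ i : Fin (Fintype.card V), (X - C (μ i))

/-- For every prime power `q = p^k` there is a `(q+1)`-regular bipartite
simple graph (the incidence graph of `PG(2,q)`, on `2(q²+q+1)` vertices) whose HL-index
`max (|λ_H|, |λ_L|)` equals `√q`.  Consequently `R(q+1) ≥ √q`, i.e. `R(d) ≥ √(d-1)` for
`d = q+1`: `√q` belongs to the set of HL-indices of graphs of maximum degree at most `q+1`. -/
theorem exists_bipartite_regular_graph_hl_index_eq_sqrt
    (p : ℕ) (hp : p.Prime) (k : ℕ) (hk : 1 ≤ k) (q : ℕ) (hq : q = p ^ k) :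
    (∃ (n : ℕ) (G : SimpleGraph (Fin n)) (_ : DecidableRel G.Adj),
      n = 2 * (q ^ 2 + q + 1) ∧
      G.IsRegularOfDegree (q + 1) ∧
      G.Colorable 2 ∧
      ∀ (μ : Fin (Fintype.card (Fin n)) → ℝ), G.IsEigenvalueSeq μ →
        ∀ (H L : Fin (Fintype.card (Fin n))),
          (H : ℕ) = (n - 1) / 2 → (L : ℕ) = n / 2 →
          max |μ H| |μ L| = Real.sqrt q) ∧
    Real.sqrt q ∈ {r : ℝ | ∃ (n : ℕ) (G : SimpleGraph (Fin n)) (_ : DecidableRel G.Adj)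
      (μ : Fin (Fintype.card (Fin n)) → ℝ) (H L : Fin (Fintype.card (Fin n))),
      (∀ v, G.degree v ≤ q + 1) ∧ G.IsEigenvalueSeq μ ∧
      (H : ℕ) = (n - 1) / 2 ∧ (L : ℕ) = n / 2 ∧ r = max |μ H| |μ L|} := by
  classical
  obtain ⟨n, G, hn, hdeg, hcol, hchar⟩ := hl_exists_graph p hp k hk q hq
  have hq1 : 1 ≤ q := by rw [hq]; exact Nat.pos_of_ne_zero (pow_ne_zero _ hp.ne_zero)
  have hmain : ∀ (μ : Fin (Fintype.card (Fin n)) → ℝ), G.IsEigenvalueSeq μ →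
        ∀ (H L : Fin (Fintype.card (Fin n))),
          (H : ℕ) = (n - 1) / 2 → (L : ℕ) = n / 2 →
          max |μ H| |μ L| = Real.sqrt q := by
    intro μ hμ H L hH hL
    refine hl_mid_eigs q (q ^ 2 + q) (Fintype.card (Fin n)) hq1 (by rw [Fintype.card_fin, hn])
      (by nlinarith) μ hμ.1 ?_ H L (by simpa using hH)
      (by simpa using hL)
    rw [← hchar, ← hμ.2]
  refine ⟨⟨n, G, inferInstance, hn, fun v => by convert hdeg v, hcol, hmain⟩, ?_⟩
  have hHerm : (G.adjMatrix ℝ).IsHermitian := G.isHermitian_adjMatrix ℝ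
  have hseq : G.IsEigenvalueSeq hHerm.eigenvalues₀ := by
    refine ⟨hHerm.eigenvalues₀_antitone, ?_⟩
    have h1 := hHerm.charpoly_eq
    have h2 : ∏ i, (Polynomial.X - Polynomial.C (hHerm.eigenvalues i)) =
        ∏ i, (Polynomial.X - Polynomial.C (hHerm.eigenvalues₀ i)) := by
      unfold Matrix.IsHermitian.eigenvalues
      exact Equiv.prod_comp (Fintype.equivOfCardEq (Fintype.card_fin _)).symm
        (fun i => Polynomial.X - Polynomial.C (hHerm.eigenvalues₀ i))
    rw [← h2]
    refine Eq.trans ?_ h1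
    congr!
  have hc : Fintype.card (Fin n) = n := Fintype.card_fin n
  refine ⟨n, G, inferInstance, hHerm.eigenvalues₀, ⟨(n - 1) / 2, by omega⟩,
    ⟨n / 2, by omega⟩, fun v => le_of_eq (by convert hdeg v), hseq, rfl, rfl, ?_⟩
  exact (hmain _ hseq _ _ rfl rfl).symm
end

section
/- Let G be a finite simple graph on n ≥ 1 vertices with maximum degree at most 3 (a subcubic graph). Then the median eigenvalues of G satisfy −√2 ≤ λ_L ≤ λ_H ≤ √2; in particular R(G) ≤ √2. -/
namespace SubcubicMedian

set_option linter.unusedSectionVars false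


open Finset Matrix

/-- A subspace on which the form is negative definite against a coordinate subspace on which it
is nonnegative: dimension bound. -/
lemma neg_card_le {V : Type*} [Fintype V] [DecidableEq V] (M : Matrix V V ℝ)
    (U : Submodule ℝ (V → ℝ)) (hneg : ∀ z ∈ U, z ≠ 0 → z ⬝ᵥ (M *ᵥ z) < 0)
    (B : Finset V) (hA : ∀ x : V → ℝ, (∀ v ∈ B, x v = 0) → 0 ≤ x ⬝ᵥ (M *ᵥ x)) :
    Module.finrank ℝ U ≤ B.card := by
  let f : U →ₗ[ℝ] (B → ℝ) := (LinearMap.funLeft ℝ ℝ (fun b : B => (b : V))).comp U.subtype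
  have hf : Function.Injective f := by
    rw [injective_iff_map_eq_zero]
    intro z hz
    by_contra hne
    have h1 := hneg z.1 z.2 (by simpa using hne)
    have h2 := hA z.1 (fun v hv => congrFun hz ⟨v, hv⟩)
    linarith
  have := LinearMap.finrank_le_finrank_of_injective hf
  simpa using this

lemma neg_of_orth {V : Type*} [Fintype V] [DecidableEq V] (M : Matrix V V ℝ) (hM : Mᵀ = M)
    (U : Submodule ℝ (V → ℝ)) (hneg : ∀ z ∈ U, z ≠ 0 → z ⬝ᵥ (M *ᵥ z) < 0)
    (B : Finset V) (hA : ∀ x : V → ℝ, (∀ v ∈ B, x v = 0) → 0 ≤ x ⬝ᵥ (M *ᵥ x))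
    (hU : B.card ≤ Module.finrank ℝ U) (z : V → ℝ) (hz : ∀ a, a ∉ B → (M *ᵥ z) a = 0)
    (b : V) (hb : b ∈ B) (hzb : z b ≠ 0) : z ⬝ᵥ (M *ᵥ z) < 0 := by
  let f : U →ₗ[ℝ] (B → ℝ) := (LinearMap.funLeft ℝ ℝ (fun b : B => (b : V))).comp U.subtype
  have hf : Function.Injective f := by
    rw [injective_iff_map_eq_zero]
    intro z hz
    by_contra hne
    have h1 := hneg z.1 z.2 (by simpa using hne)
    have h2 := hA z.1 (fun v hv => congrFun hz ⟨v, hv⟩)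
    linarith
  have hle := LinearMap.finrank_le_finrank_of_injective hf
  have heq : Module.finrank ℝ U = Module.finrank ℝ (B → ℝ) := by
    apply le_antisymm hle
    simpa using hU
  have hs : Function.Surjective f :=
    (LinearMap.injective_iff_surjective_of_finrank_eq_finrank heq).1 hf
  obtain ⟨u, hu⟩ := hs (fun b => z b)
  have hu' : ∀ v ∈ B, u.1 v = z v := fun v hv => congrFun hu ⟨v, hv⟩
  set x : V → ℝ := u.1 - z with hx
  have hxB : ∀ v ∈ B, x v = 0 := fun v hv => by simp [hx, hu' v hv]
  have h1 := hneg u.1 u.2 (fun h => hzb (by rw [← hu' b hb, h]; rfl))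
  have h2 := hA x hxB
  have h3 : x ⬝ᵥ (M *ᵥ z) = 0 := by
    apply Finset.sum_eq_zero
    intro v _
    by_cases hv : v ∈ B
    · simp [hxB v hv]
    · simp [hz v hv]
  have h4 : z ⬝ᵥ (M *ᵥ x) = 0 := by
    rw [← h3, dotProduct_mulVec, ← mulVec_transpose, hM, dotProduct_comm]
  have h5 : u.1 = x + z := by simp [hx]
  rw [h5, mulVec_add, add_dotProduct, dotProduct_add, dotProduct_add, h3, h4] at h1
  linarith

/-! ### Cuts -/

section cuts

variable {V : Type*} [Fintype V] [DecidableEq V] (G : SimpleGraph V) [DecidableRel G.Adj]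

/-- number of ordered pairs of adjacent vertices on the same side -/
def energy (s : V → Bool) : ℕ := ∑ u, ∑ v, if G.Adj u v ∧ s v = s u then 1 else 0

/-- neighbours on the same side -/
def inn (s : V → Bool) (v : V) : Finset V := univ.filter fun u => G.Adj v u ∧ s u = s v

/-- neighbours across the cut -/
def nbr (s : V → Bool) (v : V) : Finset V := univ.filter fun u => G.Adj v u ∧ s u ≠ s v

/-- maximum cut -/
def IsMax (s : V → Bool) : Prop := ∀ s', energy G s ≤ energy G s'

/-- a vertex having a neighbour on its side -/
def Mat (s : V → Bool) (v : V) : Prop := ∃ u, G.Adj v u ∧ s u = s v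

/-- move a vertex to the other side -/
def flip (s : V → Bool) (v : V) : V → Bool := Function.update s v (!s v)

lemma exists_isMax : ∃ s, IsMax G s := by
  obtain ⟨s, hs⟩ := Finite.exists_min (energy G)
  exact ⟨s, hs⟩

variable {G}

lemma card_inn_add_nbr (s : V → Bool) (v : V) :
    (inn G s v).card + (nbr G s v).card = G.degree v := by
  have h : G.degree v = (univ.filter fun u => G.Adj v u).card := by
    rw [← G.card_neighborFinset_eq_degree, G.neighborFinset_eq_filter]
  rw [h, inn, nbr, ← Finset.filter_filter, ← Finset.filter_filter,
    Finset.card_filter_add_card_filter_not]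

lemma flip_self (s : V → Bool) (v : V) : flip s v v = !s v := by simp [flip]

lemma flip_ne (s : V → Bool) {v u : V} (h : u ≠ v) : flip s v u = s u := by simp [flip, h]

lemma energy_flip (s : V → Bool) (v : V) :
    energy G (flip s v) + 2 * (inn G s v).card = energy G s + 2 * (nbr G s v).card := by
  have hi : (inn G s v).card = ∑ u, if G.Adj v u ∧ s u = s v then 1 else 0 := by
    rw [inn, Finset.card_filter]
  have hn : (nbr G s v).card = ∑ u, if G.Adj v u ∧ s u ≠ s v then 1 else 0 := by
    rw [nbr, Finset.card_filter]
  -- pointwise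
  have key : ∀ u w, (if G.Adj u w ∧ flip s v w = flip s v u then 1 else 0)
      + ((if u = v then (if G.Adj v w ∧ s w = s v then 1 else 0) else 0)
      + (if w = v then (if G.Adj v u ∧ s u = s v then 1 else 0) else 0))
      = (if G.Adj u w ∧ s w = s u then 1 else 0)
      + ((if u = v then (if G.Adj v w ∧ s w ≠ s v then 1 else 0) else 0)
      + (if w = v then (if G.Adj v u ∧ s u ≠ s v then 1 else 0) else 0)) := by
    intro u w
    by_cases hu : u = v
    · subst hu
      by_cases hw : w = u
      · subst hw; simp
      · simp only [flip_self, flip_ne s hw, hw, if_true, if_false]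
        cases s u <;> cases s w <;> simp
    · by_cases hw : w = v
      · subst hw
        simp only [flip_self, flip_ne s hu, hu, if_true, if_false, G.adj_comm w u]
        cases s u <;> cases s w <;> simp
      · simp [flip_ne s hw, flip_ne s hu, hu, hw]
  have := Finset.sum_congr rfl fun u (_ : u ∈ (univ : Finset V)) =>
    Finset.sum_congr rfl fun w (_ : w ∈ (univ : Finset V)) => key u w
  simp only [Finset.sum_add_distrib] at this
  have e1 : ∀ f : V → ℕ, (∑ u : V, ∑ w : V, if u = v then f w else 0) = ∑ w, f w := by
    intro f
    rw [Finset.sum_eq_single v] <;> simp +contextual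
  have e2 : ∀ f : V → ℕ, (∑ u : V, ∑ w : V, if w = v then f u else 0) = ∑ w, f w := by
    intro f
    simp
  rw [e1 (fun w => if G.Adj v w ∧ s w = s v then 1 else 0),
    e2 (fun w => if G.Adj v w ∧ s w = s v then 1 else 0),
    e1 (fun w => if G.Adj v w ∧ s w ≠ s v then 1 else 0),
    e2 (fun w => if G.Adj v w ∧ s w ≠ s v then 1 else 0)] at this
  rw [hi, hn, energy, energy]
  omega

lemma IsMax.inn_le (hdeg : ∀ v, G.degree v ≤ 3) {s : V → Bool} (hs : IsMax G s) (v : V) :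
    (inn G s v).card ≤ 1 := by
  have h1 := energy_flip (G := G) s v
  have h2 := hs (flip s v)
  have h3 := card_inn_add_nbr (G := G) s v
  have h4 := hdeg v
  omega

lemma IsMax.unique (hdeg : ∀ v, G.degree v ≤ 3) {s : V → Bool} (hs : IsMax G s) {v u w : V}
    (h1 : G.Adj v u) (h2 : s u = s v) (h3 : G.Adj v w) (h4 : s w = s v) : u = w := by
  have := hs.inn_le hdeg v
  rw [Finset.card_le_one] at this
  exact this u (by simp [inn, h1, h2]) w (by simp [inn, h3, h4])

/-- Swapping the ends of a cut edge whose ends are both matched gives another maximum cut. -/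
lemma IsMax.swap (hdeg : ∀ v, G.degree v ≤ 3) {s : V → Bool} (hs : IsMax G s) {a b : V}
    (hab : G.Adj a b) (hne : s a ≠ s b) (ha : Mat G s a) (hb : Mat G s b)
    (h2 : (nbr G s a).card = 2) :
    IsMax G (flip (flip s a) b) := by
  have e1 := energy_flip (G := G) s a
  have e2 := energy_flip (G := G) (flip s a) b
  have d1 := card_inn_add_nbr (G := G) s a
  have d2 := card_inn_add_nbr (G := G) (flip s a) b
  have d3 := hdeg b
  have i1 : 1 ≤ (inn G s a).card := by
    obtain ⟨u, hu⟩ := ha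
    exact Finset.card_pos.2 ⟨u, by simpa [inn] using hu⟩
  have i2 : 2 ≤ (inn G (flip s a) b).card := by
    obtain ⟨u, hu, hu'⟩ := hb
    have hua : u ≠ a := by rintro rfl; exact hne hu'
    have hba : b ≠ a := hab.ne'
    have : ({a, u} : Finset V) ⊆ inn G (flip s a) b := by
      intro x hx
      simp only [Finset.mem_insert, Finset.mem_singleton] at hx
      rcases hx with rfl | rfl
      · simp only [inn, Finset.mem_filter, Finset.mem_univ, true_and, flip_self, flip_ne s hba]
        refine ⟨hab.symm, ?_⟩
        revert hne; cases s x <;> cases s b <;> simp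
      · simp only [inn, Finset.mem_filter, Finset.mem_univ, true_and, flip_ne s hba,
          flip_ne s hua]
        exact ⟨hu, hu'⟩
    calc 2 = ({a, u} : Finset V).card := (Finset.card_pair hua.symm).symm
      _ ≤ _ := Finset.card_le_card this
  intro s'
  have := hs s'
  omega

lemma four_nbrs (hdeg : ∀ v, G.degree v ≤ 3) {v a b c d : V} (ha : G.Adj v a) (hb : G.Adj v b)
    (hc : G.Adj v c) (hd : G.Adj v d) (h1 : a ≠ b) (h2 : a ≠ c) (h3 : a ≠ d) (h4 : b ≠ c)
    (h5 : b ≠ d) (h6 : c ≠ d) : False := by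
  have h : ({a, b, c, d} : Finset V) ⊆ G.neighborFinset v := by
    intro x hx
    simp only [Finset.mem_insert, Finset.mem_singleton] at hx
    rcases hx with rfl | rfl | rfl | rfl <;> simpa
  have h7 := Finset.card_le_card h
  have h8 : ({a, b, c, d} : Finset V).card = 4 := by
    rw [Finset.card_eq_succ]
    refine ⟨a, {b, c, d}, by simp [*], rfl, ?_⟩
    rw [Finset.card_eq_three]
    exact ⟨b, c, d, h4, h5, h6, rfl⟩
  have := hdeg v
  rw [h8, G.card_neighborFinset_eq_degree] at h7
  omega

end cuts

/-! ### The quadratic form -/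

section form

variable {V : Type*} [Fintype V] [DecidableEq V] (G : SimpleGraph V) [DecidableRel G.Adj]

/-- the matrix `√2 - ε A` -/
noncomputable def mx (ε : ℝ) : Matrix V V ℝ :=
  Real.sqrt 2 • (1 : Matrix V V ℝ) - ε • G.adjMatrix ℝ

variable {G}

lemma mx_transpose (ε : ℝ) : (mx G ε)ᵀ = mx G ε := by
  simp [mx]

lemma mx_apply (ε : ℝ) (z : V → ℝ) (v : V) :
    (mx G ε *ᵥ z) v = Real.sqrt 2 * z v - ε * ∑ u, if G.Adj v u then z u else 0 := by
  simp only [mx, sub_mulVec, smul_mulVec, one_mulVec, Pi.sub_apply, Pi.smul_apply, smul_eq_mul,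
    SimpleGraph.adjMatrix_mulVec_apply]
  rw [SimpleGraph.neighborFinset_eq_filter, Finset.sum_filter]

lemma one_le_sqrt_two : (1 : ℝ) ≤ Real.sqrt 2 := by
  rw [Real.le_sqrt] <;> norm_num

lemma nonneg_side (hdeg : ∀ v, G.degree v ≤ 3) {s : V → Bool} (hs : IsMax G s)
    {ε : ℝ} (hε : ε * ε = 1) (β : Bool) (x : V → ℝ)
    (hx : ∀ v ∈ univ.filter (fun v => s v = β), x v = 0) : 0 ≤ x ⬝ᵥ (mx G ε *ᵥ x) := by
  have hx' : ∀ v, s v = β → x v = 0 := fun v hv => hx v (by simp [hv])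
  have h0 : 0 ≤ ∑ v, ∑ u, if G.Adj v u ∧ s u = s v then (x v - ε * x u) ^ 2 else 0 := by
    apply Finset.sum_nonneg; intro v _; apply Finset.sum_nonneg; intro u _
    split_ifs <;> positivity
  have h1 : ∀ v u, (if G.Adj v u ∧ s u = s v then (x v - ε * x u) ^ 2 else 0)
      = (if G.Adj v u ∧ s u = s v then (x v) ^ 2 else 0)
        + (if G.Adj v u ∧ s u = s v then (x u) ^ 2 else 0)
        - 2 * ε * (x v * if G.Adj v u then x u else 0) := by
    intro v u
    by_cases ha : G.Adj v u
    · by_cases hsu : s u = s v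
      · simp only [ha, hsu, and_self, if_true]
        linear_combination (x u) ^ 2 * hε
      · have : x v * x u = 0 := by
          by_cases hv : s v = β
          · simp [hx' v hv]
          · have : s u = β := by
              revert hsu hv; cases s u <;> cases s v <;> cases β <;> simp
            simp [hx' u this]
        simp [ha, hsu, this]
    · simp [ha]
  simp only [h1, Finset.sum_sub_distrib, Finset.sum_add_distrib] at h0
  have h2 : ∑ v, ∑ u, (if G.Adj v u ∧ s u = s v then (x u) ^ 2 else 0)
      = ∑ v, ∑ u, (if G.Adj v u ∧ s u = s v then (x v) ^ 2 else 0) := by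
    rw [Finset.sum_comm]
    refine Finset.sum_congr rfl fun v _ => Finset.sum_congr rfl fun u _ => ?_
    simp only [G.adj_comm u v, eq_comm]
  have h3 : ∑ v, ∑ u, (if G.Adj v u ∧ s u = s v then (x v) ^ 2 else 0) ≤ ∑ v, (x v) ^ 2 := by
    apply Finset.sum_le_sum
    intro v _
    rw [← Finset.sum_filter, Finset.sum_const, nsmul_eq_mul]
    have := hs.inn_le hdeg v
    have h : ((inn G s v).card : ℝ) ≤ 1 := by exact_mod_cast this
    rw [inn] at h
    nlinarith [sq_nonneg (x v)]
  have h4 : x ⬝ᵥ (mx G ε *ᵥ x) = Real.sqrt 2 * ∑ v, (x v) ^ 2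
      - ∑ v, ∑ u, ε * (x v * if G.Adj v u then x u else 0) := by
    simp only [dotProduct, mx_apply]
    rw [Finset.mul_sum, ← Finset.sum_sub_distrib]
    refine Finset.sum_congr rfl fun v _ => ?_
    rw [← Finset.mul_sum, ← Finset.mul_sum]
    ring
  have h5 : ∑ v, ∑ u, 2 * ε * (x v * if G.Adj v u then x u else 0)
      = 2 * ∑ v, ∑ u, ε * (x v * if G.Adj v u then x u else 0) := by
    simp only [Finset.mul_sum, mul_assoc]
  rw [h4]
  rw [h2, h5] at h0
  have h6 : 0 ≤ ∑ v, (x v) ^ 2 := Finset.sum_nonneg fun v _ => sq_nonneg _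
  nlinarith [one_le_sqrt_two]

variable (G) in
/-- The contradiction hypothesis: a large subspace on which `√2 - ε A` is negative definite. -/
def Bad (ε : ℝ) : Prop := ∃ U : Submodule ℝ (V → ℝ),
  (Fintype.card V + 1) / 2 ≤ Module.finrank ℝ U ∧ ∀ z ∈ U, z ≠ 0 → z ⬝ᵥ (mx G ε *ᵥ z) < 0

lemma Bad.key {ε : ℝ} (hB : Bad G ε) (hdeg : ∀ v, G.degree v ≤ 3) {s : V → Bool}
    (hs : IsMax G s) (hε : ε * ε = 1) (b : V) (z : V → ℝ)
    (hz : ∀ a, s a ≠ s b → (mx G ε *ᵥ z) a = 0) (hzb : z b ≠ 0) : z ⬝ᵥ (mx G ε *ᵥ z) < 0 := by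
  obtain ⟨U, hU, hneg⟩ := hB
  have h1 := neg_card_le (mx G ε) U hneg (univ.filter fun v => s v = !s b)
    (nonneg_side hdeg hs hε _)
  refine neg_of_orth (mx G ε) (mx_transpose ε) U hneg (univ.filter fun v => s v = s b)
    (nonneg_side hdeg hs hε _) ?_ z ?_ b (by simp) hzb
  · have h2 : (univ.filter fun v => s v = s b).card + (univ.filter fun v => s v = !s b).card
        = Fintype.card V := by
      have : (univ.filter fun v => s v = !s b) = univ.filter fun v => ¬ (s v = s b) := by
        ext v; simp only [Finset.mem_filter, Finset.mem_univ, true_and]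
        cases s v <;> cases s b <;> simp
      rw [this, Finset.card_filter_add_card_filter_not, Finset.card_univ]
    omega
  · intro a ha
    exact hz a (by simpa using ha)

open Classical in
variable (G) in
/-- inverse of the form on one side of the cut -/
noncomputable def rr (ε : ℝ) (s : V → Bool) (v c : V) : ℝ :=
  if v = c then (if Mat G s c then Real.sqrt 2 else Real.sqrt 2 / 2)
  else if G.Adj v c ∧ s v = s c then ε else 0

lemma sqrt_two_sq : Real.sqrt 2 * Real.sqrt 2 = 2 := Real.mul_self_sqrt (by norm_num)

lemma mx_rr_same (hdeg : ∀ v, G.degree v ≤ 3) {s : V → Bool}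
    (hs : IsMax G s) {ε : ℝ} (hε : ε * ε = 1) {a c : V} (hac : s a = s c) :
    (mx G ε *ᵥ (fun v => rr G ε s v c)) a = if a = c then 1 else 0 := by
  classical
  rw [mx_apply]
  by_cases hm : Mat G s c
  · obtain ⟨d, hd, hsd⟩ := hm
    have hm : Mat G s c := ⟨d, hd, hsd⟩
    have hr : ∀ v, rr G ε s v c = (if v = c then Real.sqrt 2 else 0) + if v = d then ε else 0 := by
      intro v
      by_cases h1 : v = c
      · subst h1; simp [rr, hm, hd.ne]
      · by_cases h2 : v = d
        · subst h2; simp [rr, h1, hd.symm, hsd]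
        · have : ¬ (G.Adj v c ∧ s v = s c) := fun h =>
            h2 (hs.unique hdeg h.1.symm h.2 hd hsd)
          simp [rr, h1, h2, this]
    have hsum : (∑ u, if G.Adj a u then rr G ε s u c else 0)
        = (if G.Adj a c then Real.sqrt 2 else 0) + if G.Adj a d then ε else 0 := by
      have : ∀ u, (if G.Adj a u then rr G ε s u c else 0)
          = (if u = c then (if G.Adj a c then Real.sqrt 2 else 0) else 0)
            + if u = d then (if G.Adj a d then ε else 0) else 0 := by
        intro u
        rw [hr]
        by_cases h1 : u = c
        · subst h1; simp [hd.ne]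
        · by_cases h2 : u = d
          · subst h2; simp [h1]
          · simp [h1, h2]
      simp [this, Finset.sum_add_distrib]
    rw [hsum, hr]
    have e1 : G.Adj a c ↔ a = d := by
      constructor
      · intro h; exact hs.unique hdeg h.symm hac hd hsd
      · rintro rfl; exact hd.symm
    have e2 : G.Adj a d ↔ a = c := by
      constructor
      · intro h; exact hs.unique hdeg h.symm (hac.trans hsd.symm) hd.symm hsd.symm
      · rintro rfl; exact hd
    simp only [e1, e2]
    by_cases h1 : a = c
    · subst h1
      simp only [if_true, hd.ne, if_false]
      linear_combination sqrt_two_sq - hε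
    · by_cases h2 : a = d
      · subst h2; simp [h1]; ring
      · simp [h1, h2]
  · have hr : ∀ v, rr G ε s v c = (if v = c then Real.sqrt 2 / 2 else 0) := by
      intro v
      by_cases h1 : v = c
      · subst h1; simp [rr, hm]
      · have : ¬ (G.Adj v c ∧ s v = s c) := fun h => hm ⟨v, h.1.symm, h.2⟩
        simp [rr, h1, this]
    have hsum : (∑ u, if G.Adj a u then rr G ε s u c else 0) = 0 := by
      apply Finset.sum_eq_zero
      intro u _
      rw [hr]
      by_cases h1 : u = c
      · subst h1
        have : ¬ G.Adj a u := fun h => hm ⟨a, h.symm, hac⟩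
        simp [this]
      · simp [h1]
    rw [hsum, hr]
    split_ifs
    · linear_combination sqrt_two_sq / 2
    · simp

lemma mx_rr_other {s : V → Bool} {ε : ℝ} {b c : V} (hbc : s b ≠ s c) :
    (mx G ε *ᵥ (fun v => rr G ε s v c)) b = - ε * ∑ u ∈ nbr G s b, rr G ε s u c := by
  have h0 : ∀ v, s v ≠ s c → rr G ε s v c = 0 := by
    intro v hv
    have : v ≠ c := by rintro rfl; exact hv rfl
    simp [rr, this, hv]
  rw [mx_apply, h0 b hbc, nbr, Finset.sum_filter]
  have : ∀ u, (if G.Adj b u then rr G ε s u c else 0)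
      = if G.Adj b u ∧ s u ≠ s b then rr G ε s u c else 0 := by
    intro u
    by_cases h1 : s u = s b
    · simp [h1, h0 u (by rw [h1]; exact hbc)]
    · simp [h1]
  simp only [this]
  ring

variable (G) in
/-- sum of `rr` over the cross neighbourhoods -/
noncomputable def RR (ε : ℝ) (s : V → Bool) (b b' : V) : ℝ :=
  ∑ u ∈ nbr G s b, ∑ c ∈ nbr G s b', rr G ε s u c

variable (G) in
/-- the test vector of a vertex -/
noncomputable def zz (ε : ℝ) (s : V → Bool) (b : V) : V → ℝ :=
  Pi.single b 1 + ε • ∑ c ∈ nbr G s b, (fun v => rr G ε s v c)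

lemma zz_same {ε : ℝ} {s : V → Bool} {b v : V} (h : s v = s b) :
    zz G ε s b v = if v = b then 1 else 0 := by
  have : ∑ c ∈ nbr G s b, rr G ε s v c = 0 := by
    apply Finset.sum_eq_zero
    intro c hc
    simp only [nbr, Finset.mem_filter, Finset.mem_univ, true_and] at hc
    have h1 : v ≠ c := by rintro rfl; exact hc.2 h
    have h2 : s v ≠ s c := by rw [h]; exact hc.2.symm
    simp [rr, h1, h2]
  simp [zz, this, Pi.single_apply]

lemma mx_zz (ε : ℝ) (s : V → Bool) (b v : V) :
    (mx G ε *ᵥ zz G ε s b) v = (if v = b then Real.sqrt 2 else 0) - ε * (if G.Adj v b then 1 else 0)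
      + ε * ∑ c ∈ nbr G s b, (mx G ε *ᵥ (fun v => rr G ε s v c)) v := by
  rw [zz, mulVec_add, mulVec_smul, mulVec_sum, Pi.add_apply, Pi.smul_apply, Finset.sum_apply,
    mx_apply, Finset.sum_eq_single b]
  · simp [Pi.single_apply]
  · intro x _ hx
    simp [hx]
  · simp

lemma mx_zz_other (hdeg : ∀ v, G.degree v ≤ 3) {s : V → Bool}
    (hs : IsMax G s) {ε : ℝ} (hε : ε * ε = 1) {a b : V} (h : s a ≠ s b) :
    (mx G ε *ᵥ zz G ε s b) a = 0 := by
  rw [mx_zz]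
  have h1 : ∑ c ∈ nbr G s b, (mx G ε *ᵥ (fun v => rr G ε s v c)) a
      = ∑ c ∈ nbr G s b, if a = c then 1 else 0 := by
    refine Finset.sum_congr rfl fun c hc => mx_rr_same hdeg hs hε ?_
    simp only [nbr, Finset.mem_filter, Finset.mem_univ, true_and] at hc
    have := hc.2
    revert h this; cases s a <;> cases s b <;> cases s c <;> simp
  rw [h1]
  have h2 : a ≠ b := by rintro rfl; exact h rfl
  simp [h2, nbr, h, G.adj_comm a b]

lemma mx_zz_same {s : V → Bool} {ε : ℝ} (hε : ε * ε = 1) {a b : V} (h : s a = s b) :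
    (mx G ε *ᵥ zz G ε s b) a =
      (if a = b then Real.sqrt 2 else 0) - ε * (if G.Adj a b then 1 else 0) - RR G ε s a b := by
  rw [mx_zz]
  have h1 : ∑ c ∈ nbr G s b, (mx G ε *ᵥ (fun v => rr G ε s v c)) a
      = - ε * RR G ε s a b := by
    rw [RR, Finset.sum_comm, Finset.mul_sum]
    refine Finset.sum_congr rfl fun c hc => mx_rr_other ?_
    simp only [nbr, Finset.mem_filter, Finset.mem_univ, true_and] at hc
    rw [h]; exact hc.2.symm
  rw [h1]
  linear_combination (- RR G ε s a b) * hε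

lemma dot_zz (hdeg : ∀ v, G.degree v ≤ 3) {s : V → Bool}
    (hs : IsMax G s) {ε : ℝ} (hε : ε * ε = 1) {a b : V} (h : s a = s b) :
    zz G ε s a ⬝ᵥ (mx G ε *ᵥ zz G ε s b) =
      (if a = b then Real.sqrt 2 else 0) - ε * (if G.Adj a b then 1 else 0) - RR G ε s a b := by
  rw [← mx_zz_same hε h, dotProduct, Finset.sum_eq_single a]
  · rw [zz_same rfl]; simp
  · intro v _ hv
    by_cases h1 : s v = s a
    · rw [zz_same h1]; simp [hv]
    · rw [mx_zz_other hdeg hs hε (by rwa [← h])]; simp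
  · simp

lemma Bad.one {ε : ℝ} (hB : Bad G ε) (hdeg : ∀ v, G.degree v ≤ 3) {s : V → Bool}
    (hs : IsMax G s) (hε : ε * ε = 1) (b : V) : Real.sqrt 2 < RR G ε s b b := by
  have := hB.key hdeg hs hε b (zz G ε s b) (fun a ha => mx_zz_other hdeg hs hε ha)
    (by rw [zz_same rfl]; simp)
  rw [dot_zz hdeg hs hε rfl] at this
  simp at this
  exact this

lemma Bad.two {ε : ℝ} (hB : Bad G ε) (hdeg : ∀ v, G.degree v ≤ 3) {s : V → Bool}
    (hs : IsMax G s) (hε : ε * ε = 1) {b c : V} (h : s b = s c) (hbc : b ≠ c) (t : ℝ) :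
    Real.sqrt 2 + t * t * Real.sqrt 2 - 2 * t * ε * (if G.Adj b c then 1 else 0) <
      RR G ε s b b + t * t * RR G ε s c c + t * (RR G ε s b c + RR G ε s c b) := by
  have := hB.key hdeg hs hε b (zz G ε s b + t • zz G ε s c)
    (fun a ha => by
      rw [mulVec_add, mulVec_smul, Pi.add_apply, Pi.smul_apply, mx_zz_other hdeg hs hε ha,
        mx_zz_other hdeg hs hε (by rwa [← h])]; simp)
    (by rw [Pi.add_apply, Pi.smul_apply, zz_same rfl, zz_same h]; simp [hbc])
  rw [mulVec_add, mulVec_smul, add_dotProduct, dotProduct_add, dotProduct_add, smul_dotProduct,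
    smul_dotProduct, dotProduct_smul, dotProduct_smul, dot_zz hdeg hs hε rfl,
    dot_zz hdeg hs hε rfl, dot_zz hdeg hs hε h, dot_zz hdeg hs hε h.symm] at this
  simp only [if_true, hbc, hbc.symm, if_false, G.adj_comm c b, SimpleGraph.irrefl,
    smul_eq_mul] at this
  linarith

end form

/-! ### Combinatorial analysis -/

section comb

variable {V : Type*} [Fintype V] [DecidableEq V] {G : SimpleGraph V} [DecidableRel G.Adj]

lemma mem_nbr {s : V → Bool} {v u : V} : u ∈ nbr G s v ↔ G.Adj v u ∧ s u ≠ s v := by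
  simp [nbr]

lemma rr_mat {ε : ℝ} {s : V → Bool} {c : V} (h : Mat G s c) : rr G ε s c c = Real.sqrt 2 := by
  simp [rr, h]

lemma rr_unm {ε : ℝ} {s : V → Bool} {c : V} (h : ¬ Mat G s c) :
    rr G ε s c c = Real.sqrt 2 / 2 := by
  simp [rr, h]

lemma rr_self_le {ε : ℝ} {s : V → Bool} {c : V} : rr G ε s c c ≤ Real.sqrt 2 := by
  by_cases h : Mat G s c
  · rw [rr_mat h]
  · rw [rr_unm h]; linarith [one_le_sqrt_two]

lemma rr_self_nonneg {ε : ℝ} {s : V → Bool} {c : V} : 0 ≤ rr G ε s c c := by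
  by_cases h : Mat G s c
  · rw [rr_mat h]; positivity
  · rw [rr_unm h]; positivity

lemma rr_adj {ε : ℝ} {s : V → Bool} {v c : V} (h : G.Adj v c) (h' : s v = s c) :
    rr G ε s v c = ε := by
  simp [rr, h.ne, h, h']

lemma rr_not_adj {ε : ℝ} {s : V → Bool} {v c : V} (h : v ≠ c) (h' : ¬ G.Adj v c) :
    rr G ε s v c = 0 := by
  simp [rr, h, h']

lemma rr_unm_left {ε : ℝ} {s : V → Bool} {v c : V} (h : v ≠ c) (h' : ¬ Mat G s v) :
    rr G ε s v c = 0 := by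
  have : ¬ (G.Adj v c ∧ s v = s c) := fun hh => h' ⟨c, hh.1, hh.2.symm⟩
  simp [rr, h, this]

lemma rr_comm {ε : ℝ} {s : V → Bool} {v c : V} : rr G ε s v c = rr G ε s c v := by
  by_cases h : v = c
  · subst h; rfl
  · have h' : c ≠ v := fun hh => h hh.symm
    simp [rr, h, h', G.adj_comm v c, eq_comm]

lemma rr_unm_right {ε : ℝ} {s : V → Bool} {v c : V} (h : v ≠ c) (h' : ¬ Mat G s c) :
    rr G ε s v c = 0 := by
  rw [rr_comm, rr_unm_left h.symm h']

lemma rr_nonneg {s : V → Bool} {v c : V} : 0 ≤ rr G 1 s v c := by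
  by_cases h : v = c
  · subst h; exact rr_self_nonneg
  · simp only [rr, h, if_false]; split_ifs <;> norm_num

lemma rr_nonpos {s : V → Bool} {v c : V} (h : v ≠ c) : rr G (-1) s v c ≤ 0 := by
  simp only [rr, h, if_false]; split_ifs <;> norm_num

lemma RR_pair {ε : ℝ} {s : V → Bool} {b c p q x y : V} (h1 : nbr G s b = {p, q}) (h2 : p ≠ q)
    (h3 : nbr G s c = {x, y}) (h4 : x ≠ y) :
    RR G ε s b c = rr G ε s p x + rr G ε s p y + rr G ε s q x + rr G ε s q y := by
  rw [RR, h1, h3, Finset.sum_pair h2, Finset.sum_pair h4, Finset.sum_pair h4]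
  ring

lemma RR_comm {ε : ℝ} {s : V → Bool} {b c : V} : RR G ε s b c = RR G ε s c b := by
  rw [RR, RR, Finset.sum_comm]
  exact Finset.sum_congr rfl fun u _ => Finset.sum_congr rfl fun v _ => rr_comm

lemma Bad.two_le_nbr {ε : ℝ} (hB : Bad G ε) (hdeg : ∀ v, G.degree v ≤ 3)
    (hε : ε * ε = 1) {s : V → Bool} (hs : IsMax G s) (b : V) :
    2 ≤ (nbr G s b).card := by
  by_contra hlt
  have h1 := hB.one hdeg hs hε b
  have h2 : (nbr G s b).card = 0 ∨ (nbr G s b).card = 1 := by omega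
  rcases h2 with h2 | h2
  · rw [Finset.card_eq_zero] at h2
    rw [RR, h2, Finset.sum_empty] at h1
    linarith [one_le_sqrt_two]
  · obtain ⟨a, ha⟩ := Finset.card_eq_one.1 h2
    rw [RR, ha, Finset.sum_singleton, Finset.sum_singleton] at h1
    linarith [rr_self_le (G := G) (ε := ε) (s := s) (c := a)]

lemma Bad.card_nbr_of_mat {ε : ℝ} (hB : Bad G ε) (hdeg : ∀ v, G.degree v ≤ 3)
    (hε : ε * ε = 1) {s : V → Bool} (hs : IsMax G s) {b : V} (hb : Mat G s b) :
    (nbr G s b).card = 2 := by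
  have h1 := hB.two_le_nbr hdeg hε hs b
  have h2 := card_inn_add_nbr (G := G) s b
  have h3 := hdeg b
  have i1 : 1 ≤ (inn G s b).card := by
    obtain ⟨u, hu⟩ := hb
    exact Finset.card_pos.2 ⟨u, by simpa [inn] using hu⟩
  omega

lemma Bad.exists_mat {ε : ℝ} (hB : Bad G ε) (hdeg : ∀ v, G.degree v ≤ 3)
    (hε : ε * ε = 1) {s : V → Bool} (hs : IsMax G s) {b : V} (hb : (nbr G s b).card = 2) :
    ∃ a ∈ nbr G s b, Mat G s a := by
  by_contra hno
  push Not at hno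
  obtain ⟨p, q, hpq, hN⟩ := Finset.card_eq_two.1 hb
  have h1 := hB.one hdeg hs hε b
  have hp := hno p (by simp [hN])
  have hq := hno q (by simp [hN])
  rw [RR_pair hN hpq hN hpq, rr_unm hp, rr_unm hq, rr_unm_left hpq hp,
    rr_unm_left hpq.symm hq] at h1
  linarith

/-- Two matched cross neighbours of a matched vertex are adjacent. -/
lemma Bad.adj_of_mat {ε : ℝ} (hB : Bad G ε) (hdeg : ∀ v, G.degree v ≤ 3)
    (hε : ε * ε = 1) {s : V → Bool} (hs : IsMax G s) {a b c : V} (ha : Mat G s a) (hb : b ∈ nbr G s a)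
    (hc : c ∈ nbr G s a) (hbc : b ≠ c) (hmb : Mat G s b) (hmc : Mat G s c) : G.Adj b c := by
  rw [mem_nbr] at hb hc
  have hmax := hs.swap hdeg hb.1 hb.2.symm ha hmb (hB.card_nbr_of_mat hdeg hε hs ha)
  obtain ⟨d, hd, hsd⟩ := hmc
  by_contra hno
  have hdb : d ≠ b := by rintro rfl; exact hno hd.symm
  have hda : d ≠ a := by rintro rfl; exact hc.2 hsd.symm
  have hca : c ≠ a := hc.1.ne'
  have hab : a ≠ b := hb.1.ne
  have hc' : flip (flip s a) b c = s c := by rw [flip_ne _ hbc.symm, flip_ne _ hca]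
  have hd' : flip (flip s a) b d = s d := by rw [flip_ne _ hdb, flip_ne _ hda]
  have ha' : flip (flip s a) b a = !s a := by rw [flip_ne _ hab, flip_self]
  have hsc : (!s a) = s c := by
    have := hc.2
    revert this; cases s a <;> cases s c <;> simp
  refine hda (hmax.unique hdeg hd ?_ hc.1.symm ?_)
  · rw [hd', hc', hsd]
  · rw [ha', hc', hsc]

/-- members of a two-element set, completed -/
lemma pair_completion {N : Finset V} {a : V} (ha : a ∈ N) (h : N.card = 2) :
    ∃ x, a ≠ x ∧ N = {a, x} := by
  obtain ⟨p, q, hpq, hN⟩ := Finset.card_eq_two.1 h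
  rw [hN, Finset.mem_insert, Finset.mem_singleton] at ha
  rcases ha with rfl | rfl
  · exact ⟨q, hpq, hN⟩
  · exact ⟨p, hpq.symm, by rw [hN, Finset.pair_comm]⟩

lemma same_side {s : V → Bool} {a b c : V} (hb : b ∈ nbr G s a) (hc : c ∈ nbr G s a) :
    s b = s c := by
  rw [mem_nbr] at hb hc
  have h1 := hb.2
  have h2 := hc.2
  revert h1 h2; cases s a <;> cases s b <;> cases s c <;> simp

lemma nbr_symm {s : V → Bool} {a b : V} (hb : b ∈ nbr G s a) : a ∈ nbr G s b := by
  rw [mem_nbr] at *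
  exact ⟨hb.1.symm, hb.2.symm⟩

/-- A matched vertex is not in a triangle with a matched pair of the other side. -/
lemma Bad.no_triangle {ε : ℝ} (hB : Bad G ε) (hdeg : ∀ v, G.degree v ≤ 3)
    (hε : ε * ε = 1) {s : V → Bool} (hs : IsMax G s) {a b c : V} (ha : Mat G s a) (hb : b ∈ nbr G s a)
    (hc : c ∈ nbr G s a) (hbc : G.Adj b c) : False := by
  have hsbc := same_side hb hc
  have hmb : Mat G s b := ⟨c, hbc, hsbc.symm⟩
  have hmc : Mat G s c := ⟨b, hbc.symm, hsbc⟩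
  have hε' : ε = 1 ∨ ε = -1 := mul_self_eq_one_iff.1 hε
  rcases hε' with rfl | rfl
  · obtain ⟨x, hax, hNb⟩ := pair_completion (nbr_symm hb) (hB.card_nbr_of_mat hdeg hε hs hmb)
    obtain ⟨y, hay, hNc⟩ := pair_completion (nbr_symm hc) (hB.card_nbr_of_mat hdeg hε hs hmc)
    have h := hB.two hdeg hs hε hsbc hbc.ne (-1)
    rw [RR_pair hNb hax hNb hax, RR_pair hNc hay hNc hay, RR_pair hNb hax hNc hay,
      RR_pair hNc hay hNb hax, if_pos hbc] at h
    rw [rr_comm (v := x) (c := a), rr_comm (v := y) (c := a), rr_comm (v := y) (c := x)] at h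
    have h1 := rr_self_le (G := G) (ε := 1) (s := s) (c := x)
    have h2 := rr_self_le (G := G) (ε := 1) (s := s) (c := y)
    have h3 := rr_nonneg (G := G) (s := s) (v := x) (c := y)
    linarith
  · obtain ⟨a', haa, hsa⟩ := ha
    have ha : Mat G s a := ⟨a', haa, hsa⟩
    have ha' : Mat G s a' := ⟨a, haa.symm, hsa.symm⟩
    obtain ⟨c', hbc', hNa⟩ := pair_completion hb (hB.card_nbr_of_mat hdeg hε hs ha)
    have hcc : c = c' := by
      rw [hNa, Finset.mem_insert, Finset.mem_singleton] at hc
      rcases hc with h | h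
      · exact absurd h hbc.ne'
      · exact h
    subst hcc
    obtain ⟨d, e, hde, hNa'⟩ := Finset.card_eq_two.1 (hB.card_nbr_of_mat hdeg hε hs ha')
    have h := hB.two hdeg hs hε hsa.symm haa.ne 1
    rw [RR_comm (b := a') (c := a), RR_pair hNa hbc' hNa hbc', RR_pair hNa' hde hNa' hde,
      RR_pair hNa hbc' hNa' hde, if_pos haa, rr_comm (v := c) (c := b), rr_comm (v := e) (c := d),
      rr_mat hmb, rr_mat hmc, rr_adj hbc hsbc] at h
    have h1 := rr_self_le (G := G) (ε := -1) (s := s) (c := d)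
    have h2 := rr_self_le (G := G) (ε := -1) (s := s) (c := e)
    have h3 := rr_nonpos (G := G) (s := s) hde
    have hs2 := sqrt_two_sq
    have hs1 := one_le_sqrt_two
    have hs3 : Real.sqrt 2 < 1.415 := by
      rw [Real.sqrt_lt' (by norm_num)]; norm_num
    have hsd : s d = s b := by
      have q1 := (mem_nbr.1 hb).2
      have q2 := (mem_nbr.1 (show d ∈ nbr G s a' by simp [hNa'])).2
      rw [hsa] at q2
      revert q1 q2; cases s a <;> cases s b <;> cases s d <;> simp
    have hse : s e = s b := by
      have q1 := (mem_nbr.1 hb).2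
      have q2 := (mem_nbr.1 (show e ∈ nbr G s a' by simp [hNa'])).2
      rw [hsa] at q2
      revert q1 q2; cases s a <;> cases s b <;> cases s e <;> simp
    -- contribution of one vertex
    have cont : ∀ x, s x = s b → x ≠ b → x ≠ c →
        rr G (-1) s b x = 0 ∧ rr G (-1) s c x = 0 := by
      intro x hx hxb hxc
      refine ⟨rr_not_adj hxb.symm fun hh => ?_, rr_not_adj hxc.symm fun hh => ?_⟩
      · exact hxc (hs.unique hdeg hh hx hbc hsbc.symm)
      · exact hxb (hs.unique hdeg hh (hx.trans hsbc) hbc.symm hsbc)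
    by_cases hdb : d = b
    · subst hdb
      rw [rr_mat hmb, rr_adj hbc.symm hsbc.symm] at h
      by_cases hec : e = c
      · subst hec
        rw [rr_mat hmc, rr_adj hbc hsbc] at h
        linarith
      · have := cont e hse hde.symm hec
        rw [this.1, this.2] at h
        linarith
    · by_cases hdc : d = c
      · subst hdc
        rw [rr_mat hmc, rr_adj hbc hsbc] at h
        by_cases heb : e = b
        · subst heb
          rw [rr_mat hmb, rr_adj hbc.symm hsbc.symm] at h
          linarith
        · have := cont e hse heb hde.symm
          rw [this.1, this.2] at h
          linarith
      · have hd0 := cont d hsd hdb hdc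
        rw [hd0.1, hd0.2] at h
        by_cases heb : e = b
        · subst heb
          rw [rr_mat hmb, rr_adj hbc.symm hsbc.symm] at h
          linarith
        · by_cases hec : e = c
          · subst hec
            rw [rr_mat hmc, rr_adj hbc hsbc] at h
            linarith
          · have := cont e hse heb hec
            rw [this.1, this.2] at h
            linarith

/-- A matched vertex has exactly one matched and one unmatched cross neighbour. -/
lemma Bad.shape {ε : ℝ} (hB : Bad G ε) (hdeg : ∀ v, G.degree v ≤ 3)
    (hε : ε * ε = 1) {s : V → Bool} (hs : IsMax G s) {b : V} (hb : Mat G s b) :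
    ∃ p q, p ≠ q ∧ nbr G s b = {p, q} ∧ Mat G s p ∧ ¬ Mat G s q := by
  have h2 := hB.card_nbr_of_mat hdeg hε hs hb
  obtain ⟨p, hp, hmp⟩ := hB.exists_mat hdeg hε hs h2
  obtain ⟨q, hpq, hN⟩ := pair_completion hp h2
  refine ⟨p, q, hpq, hN, hmp, fun hmq => ?_⟩
  have hq : q ∈ nbr G s b := by simp [hN]
  exact hB.no_triangle hdeg hε hs hb hp hq (hB.adj_of_mat hdeg hε hs hb hp hq hpq hmp hmq)

/-- Some vertex is matched. -/
lemma Bad.some_mat {ε : ℝ} (hB : Bad G ε) (hdeg : ∀ v, G.degree v ≤ 3)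
    (hε : ε * ε = 1) {s : V → Bool} (hs : IsMax G s) [Nonempty V] : ∃ b, Mat G s b := by
  by_contra hno
  push Not at hno
  have h3 : ∀ b, (nbr G s b).card = 3 := by
    intro b
    have h1 := hB.two_le_nbr hdeg hε hs b
    have h2 := card_inn_add_nbr (G := G) s b
    have h3 := hdeg b
    have h4 : (nbr G s b).card ≠ 2 := by
      intro h
      obtain ⟨a, _, ha⟩ := hB.exists_mat hdeg hε hs h
      exact hno a ha
    omega
  obtain ⟨v⟩ := ‹Nonempty V›
  have hv : 1 < (nbr G s v).card := by rw [h3]; norm_num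
  obtain ⟨b, hb, c, hc, hbc⟩ := Finset.one_lt_card.1 hv
  have hsbc := same_side hb hc
  have hadj : ¬ G.Adj b c := fun h => hno b ⟨c, h, hsbc.symm⟩
  have h := hB.two hdeg hs hε hsbc hbc (-1)
  have hrr : ∀ x y, rr G ε s x y = if x = y then Real.sqrt 2 / 2 else 0 := by
    intro x y
    by_cases hxy : x = y
    · subst hxy; rw [rr_unm (hno x)]; simp
    · rw [rr_unm_left hxy (hno x)]; simp [hxy]
  have hself : ∀ x, RR G ε s x x = 3 * (Real.sqrt 2 / 2) := by
    intro x
    rw [RR]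
    simp only [hrr, Finset.sum_ite_eq]
    rw [Finset.sum_congr rfl (fun u hu => if_pos hu), Finset.sum_const, h3, nsmul_eq_mul]
    norm_num
  have hcross : Real.sqrt 2 / 2 ≤ RR G ε s b c := by
    rw [RR]
    simp only [hrr, Finset.sum_ite_eq]
    calc Real.sqrt 2 / 2 = if v ∈ nbr G s c then Real.sqrt 2 / 2 else 0 := by
          rw [if_pos (nbr_symm hc)]
      _ ≤ _ := Finset.single_le_sum
          (f := fun x => if x ∈ nbr G s c then Real.sqrt 2 / 2 else 0)
          (fun i _ => by positivity) (nbr_symm hb)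
  rw [RR_comm (b := c) (c := b), hself, hself, if_neg hadj] at h
  linarith

/-- The case `ε = 1` is impossible; for `ε = -1` every matched pair lies in a triangle. -/
lemma Bad.pair {ε : ℝ} (hB : Bad G ε) (hdeg : ∀ v, G.degree v ≤ 3)
    (hε : ε * ε = 1) {s : V → Bool} (hs : IsMax G s) {b b' : V} (hbb : G.Adj b b') (hsb : s b = s b') :
    ε = -1 ∧ ∃ p q p', nbr G s b = {p, q} ∧ nbr G s b' = {p', q} ∧ p ≠ p' ∧ ¬ G.Adj p p' ∧
      Mat G s p ∧ Mat G s p' ∧ ¬ Mat G s q := by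
  have hb : Mat G s b := ⟨b', hbb, hsb.symm⟩
  have hb' : Mat G s b' := ⟨b, hbb.symm, hsb⟩
  obtain ⟨p, q, hpq, hN, hp, hq⟩ := hB.shape hdeg hε hs hb
  obtain ⟨p', q', hpq', hN', hp', hq'⟩ := hB.shape hdeg hε hs hb'
  have hs2 := sqrt_two_sq
  have hs1 := one_le_sqrt_two
  have hs3 : Real.sqrt 2 < 1.415 := by
    rw [Real.sqrt_lt' (by norm_num)]; norm_num
  have e1 : RR G ε s b b = 3 * (Real.sqrt 2 / 2) := by
    rw [RR_pair hN hpq hN hpq, rr_mat hp, rr_unm hq, rr_unm_right hpq hq,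
      rr_unm_left hpq.symm hq]
    ring
  have e2 : RR G ε s b' b' = 3 * (Real.sqrt 2 / 2) := by
    rw [RR_pair hN' hpq' hN' hpq', rr_mat hp', rr_unm hq', rr_unm_right hpq' hq',
      rr_unm_left hpq'.symm hq']
    ring
  have npq' : p ≠ q' := by rintro rfl; exact hq' hp
  have nqp' : q ≠ p' := by rintro rfl; exact hq hp'
  have e3 : RR G ε s b b' = rr G ε s p p' + rr G ε s q q' := by
    rw [RR_pair hN hpq hN' hpq', rr_unm_right npq' hq', rr_unm_left nqp' hq]
    ring
  have h := hB.two hdeg hs hε hsb hbb.ne (-ε)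
  rw [RR_comm (b := b') (c := b), e1, e2, e3, if_pos hbb] at h
  have hε' : ε = 1 ∨ ε = -1 := mul_self_eq_one_iff.1 hε
  rcases hε' with rfl | rfl
  · have h1 := rr_nonneg (G := G) (s := s) (v := p) (c := p')
    have h2 := rr_nonneg (G := G) (s := s) (v := q) (c := q')
    linarith
  · refine ⟨rfl, p, q, p', hN, ?_⟩
    have hpb : p ∈ nbr G s b := by simp [hN]
    have hpb' : p' ∈ nbr G s b' := by simp [hN']
    have npp : p ≠ p' := by
      rintro rfl
      exact hB.no_triangle hdeg hε hs hp (nbr_symm hpb) (nbr_symm hpb') hbb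
    have hpp := rr_nonpos (G := G) (s := s) npp
    have hqq : q = q' := by
      by_contra hne
      rw [rr_unm_left hne hq] at h
      linarith
    subst hqq
    refine ⟨hN', npp, fun hadj => ?_, hp, hp', hq⟩
    have hspp : s p = s p' := by
      have q1 := (mem_nbr.1 hpb).2
      have q2 := (mem_nbr.1 hpb').2
      rw [← hsb] at q2
      revert q1 q2; cases s p <;> cases s b <;> cases s p' <;> simp
    rw [rr_adj hadj hspp, rr_unm hq] at h
    linarith

/-- If `b`, `c` is a matched pair with common unmatched neighbour `q` and `p` is the matched
neighbour of `b`, then `q` and `p` have a common unmatched neighbour outside the pair. -/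
lemma Bad.third {ε : ℝ} (hB : Bad G ε) (hdeg : ∀ v, G.degree v ≤ 3)
    (hε : ε * ε = 1) {s : V → Bool} (hs : IsMax G s) {b b' p q p' : V} (hbb : G.Adj b b') (hsb : s b = s b')
    (hN : nbr G s b = {p, q}) (hN' : nbr G s b' = {p', q}) (hpp : p ≠ p')
    (hp : Mat G s p) (hq : ¬ Mat G s q) :
    ∃ x, x ∈ nbr G s q ∧ x ∈ nbr G s p ∧ x ≠ b ∧ x ≠ b' ∧ ¬ Mat G s x := by
  have hb : Mat G s b := ⟨b', hbb, hsb.symm⟩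
  have hpb : p ∈ nbr G s b := by simp [hN]
  have hqb : q ∈ nbr G s b := by simp [hN]
  have hqb' : q ∈ nbr G s b' := by simp [hN']
  have hpq : p ≠ q := by rintro rfl; exact hq hp
  have hspq : s p = s q := same_side hpb hqb
  obtain ⟨apb, spb⟩ := mem_nbr.1 hpb
  obtain ⟨aqb, sqb⟩ := mem_nbr.1 hqb
  obtain ⟨aqb', sqb'⟩ := mem_nbr.1 hqb'
  have hmax := hs.swap hdeg apb spb.symm hb hp (hB.card_nbr_of_mat hdeg hε hs hb)
  set t := flip (flip s b) p with htt
  have tp : t p = s b := by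
    rw [htt, flip_self, flip_ne _ apb.ne']
    revert spb; cases s p <;> cases s b <;> simp
  have tb : t b = s p := by
    rw [htt, flip_ne _ apb.ne, flip_self]
    revert spb; cases s p <;> cases s b <;> simp
  have tother : ∀ v, v ≠ b → v ≠ p → t v = s v := by
    intro v h1 h2
    rw [htt, flip_ne _ h2, flip_ne _ h1]
  have tq : t q = s q := tother q aqb.ne' hpq.symm
  have npb' : b' ≠ p := by
    rintro rfl; exact spb hsb.symm
  have tbb : t b' = s b := by rw [tother b' hbb.ne' npb', hsb]
  have hmq : Mat G t q := ⟨b, aqb.symm, by rw [tb, tq, hspq]⟩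
  have h2 := hB.card_nbr_of_mat hdeg hε hmax hmq
  have hb'q : b' ∈ nbr G t q := mem_nbr.2 ⟨aqb'.symm, by rw [tbb, tq]; exact sqb.symm⟩
  obtain ⟨x, hx, hmx⟩ := hB.exists_mat hdeg hε hmax h2
  obtain ⟨aqx, tx⟩ := mem_nbr.1 hx
  have hxb : x ≠ b := by
    rintro rfl; exact tx (by rw [tb, tq, hspq])
  have hxp : x ≠ p := by
    rintro rfl; exact hq ⟨x, aqx, hspq⟩
  have sx : s x ≠ s q := by
    rw [tq, tother x hxb hxp] at tx; exact tx
  have sxb : s x = s b := by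
    revert sx sqb; cases s x <;> cases s q <;> cases s b <;> simp
  have hxb' : x ≠ b' := by
    rintro rfl
    obtain ⟨y, hy, sy⟩ := hmx
    rw [tbb] at sy
    have hyb : y ≠ b := by rintro rfl; rw [tb] at sy; exact spb sy
    by_cases hyp : y = p
    · subst hyp
      have : y ∈ nbr G s x := mem_nbr.2 ⟨hy, by rw [← hsb]; exact spb⟩
      rw [hN', Finset.mem_insert, Finset.mem_singleton] at this
      rcases this with h | h
      · exact hpp h
      · exact hpq h
    · rw [tother y hyb hyp] at sy
      exact hyb (hs.unique hdeg hy (sy.trans hsb) hbb.symm hsb)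
  have hxq : x ∈ nbr G s q := mem_nbr.2 ⟨aqx, sx⟩
  -- `x` is unmatched in the old cut
  have hux : ¬ Mat G s x := by
    rintro ⟨y, hy, sy⟩
    obtain ⟨_, p1, q1, p2, hN1, hN2, _, _, hp1, _, hq1⟩ := hB.pair hdeg hε hs hy sy.symm
    have hqx := nbr_symm hxq
    have : q = q1 := by
      rw [hN1, Finset.mem_insert, Finset.mem_singleton] at hqx
      rcases hqx with h | h
      · rw [h] at hq; exact absurd hp1 hq
      · exact h
    subst this
    have hqy : q ∈ nbr G s y := by simp [hN2]
    have hyb : y ≠ b := by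
      rintro rfl
      exact hxb' (hs.unique hdeg hy.symm sxb hbb hsb.symm)
    have hyb' : y ≠ b' := by
      rintro rfl
      exact hxb (hs.unique hdeg hy.symm (sxb.trans hsb) hbb.symm hsb)
    exact four_nbrs hdeg aqb.symm aqb'.symm aqx (mem_nbr.1 hqy).1.symm hbb.ne hxb.symm hyb.symm
      hxb'.symm hyb'.symm hy.ne
  refine ⟨x, hxq, ?_, hxb, hxb', hux⟩
  obtain ⟨y, hy, sy⟩ := hmx
  rw [tother x hxb hxp] at sy
  by_cases hyp : y = p
  · subst hyp
    exact mem_nbr.2 ⟨hy.symm, by rw [sxb]; exact spb.symm⟩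
  · exfalso
    have hyb : y ≠ b := by
      rintro rfl; rw [tb, sxb] at sy; exact spb sy
    rw [tother y hyb hyp] at sy
    exact hux ⟨y, hy, sy⟩

theorem Bad.elim {ε : ℝ} (hB : Bad G ε) (hdeg : ∀ v, G.degree v ≤ 3)
    (hε : ε * ε = 1) [Nonempty V] : False := by
  obtain ⟨s, hs⟩ := exists_isMax G
  obtain ⟨b, hb⟩ := hB.some_mat hdeg hε hs
  obtain ⟨b', hbb, hsb⟩ := hb
  obtain ⟨_, p, q, p', hN, hN', hpp, hadj, hp, hp', hq⟩ := hB.pair hdeg hε hs hbb hsb.symm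
  obtain ⟨x, hxq, hxp, hxb, hxb', hux⟩ :=
    hB.third hdeg hε hs hbb hsb.symm hN hN' hpp hp hq
  obtain ⟨y, hyq, hyp, hyb', hyb, huy⟩ :=
    hB.third hdeg hε hs hbb.symm hsb hN' hN hpp.symm hp' hq
  have hqb : q ∈ nbr G s b := by simp [hN]
  have hqb' : q ∈ nbr G s b' := by simp [hN']
  have hxy : x = y := by
    by_contra hne
    exact four_nbrs hdeg (mem_nbr.1 hqb).1.symm (mem_nbr.1 hqb').1.symm (mem_nbr.1 hxq).1
      (mem_nbr.1 hyq).1 hbb.ne hxb.symm hyb.symm hxb'.symm hyb'.symm hne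
  subst hxy
  obtain ⟨r, hpr, hsr⟩ := hp
  obtain ⟨_, p1, q1, p2, hN1, hN2, _, _, hp1, _, hq1⟩ := hB.pair hdeg hε hs hpr hsr.symm
  have hxq1 : x = q1 := by
    rw [hN1, Finset.mem_insert, Finset.mem_singleton] at hxp
    rcases hxp with h | h
    · rw [h] at hux; exact absurd hp1 hux
    · exact h
  have hxp : x ∈ nbr G s p := by rw [hN1, hxq1]; simp
  have hxr : x ∈ nbr G s r := by rw [hN2, hxq1]; simp
  have hmp : Mat G s p := ⟨r, hpr, hsr⟩
  have hmr : Mat G s r := ⟨p, hpr.symm, hsr.symm⟩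
  refine four_nbrs hdeg (mem_nbr.1 hxq).1.symm (mem_nbr.1 hxp).1.symm (mem_nbr.1 hyp).1.symm
    (mem_nbr.1 hxr).1.symm ?_ ?_ ?_ hpp hpr.ne ?_
  · rintro rfl; exact hq hmp
  · rintro rfl; exact hq hp'
  · rintro rfl; exact hq hmr
  · rintro rfl; exact hadj hpr

end comb

/-! ### Spectral part -/

section spectral

variable {V : Type*} [Fintype V] [DecidableEq V] {G : SimpleGraph V} [DecidableRel G.Adj]

lemma bad_of_card (hA : (G.adjMatrix ℝ).IsHermitian) (ε : ℝ)
    (h : (Fintype.card V + 1) / 2 ≤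
      (univ.filter fun j => Real.sqrt 2 < ε * hA.eigenvalues j).card) : Bad G ε := by
  classical
  let J := univ.filter fun j => Real.sqrt 2 < ε * hA.eigenvalues j
  let w : V → V → ℝ := fun j => (hA.eigenvectorBasis j).ofLp
  have horth : ∀ i j, w i ⬝ᵥ w j = if i = j then 1 else 0 := by
    intro i j
    have := (orthonormal_iff_ite.1 hA.eigenvectorBasis.orthonormal) j i
    rw [EuclideanSpace.inner_eq_star_dotProduct] at this
    simpa [w, eq_comm] using this
  have heig : ∀ j, mx G ε *ᵥ w j = (Real.sqrt 2 - ε * hA.eigenvalues j) • w j := by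
    intro j
    have := hA.mulVec_eigenvectorBasis j
    rw [mx, sub_mulVec, smul_mulVec, smul_mulVec, one_mulVec]
    change _ - ε • (SimpleGraph.adjMatrix ℝ G *ᵥ (hA.eigenvectorBasis j).ofLp) = _
    rw [this, sub_smul, mul_smul]
  have hdot : ∀ (c d : J → ℝ), (∑ i, c i • w i) ⬝ᵥ (∑ i, d i • w i) = ∑ i, c i * d i := by
    intro c d
    rw [sum_dotProduct]
    refine Finset.sum_congr rfl fun i _ => ?_
    rw [dotProduct_sum, Finset.sum_eq_single i]
    · rw [smul_dotProduct, dotProduct_smul, horth]; simp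
    · intro j _ hj
      have : (i : V) ≠ j := fun hh => hj (Subtype.ext hh.symm)
      rw [smul_dotProduct, dotProduct_smul, horth]; simp [this]
    · simp
  have hli : LinearIndependent ℝ (fun j : J => w j) := by
    rw [Fintype.linearIndependent_iff]
    intro c hc
    have h0 := hdot c c
    rw [hc, zero_dotProduct] at h0
    have := (Finset.sum_eq_zero_iff_of_nonneg (fun i _ => mul_self_nonneg (c i))).1 h0.symm
    intro i
    simpa using this i (Finset.mem_univ i)
  refine ⟨Submodule.span ℝ (Set.range fun j : J => w j), ?_, ?_⟩
  · rw [finrank_span_eq_card hli, Fintype.card_coe]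
    exact h
  · intro z hz hne
    obtain ⟨c, rfl⟩ := (Submodule.mem_span_range_iff_exists_fun ℝ).1 hz
    have hM : mx G ε *ᵥ (∑ i, c i • w i)
        = ∑ i : J, (c i * (Real.sqrt 2 - ε * hA.eigenvalues i)) • w i := by
      rw [mulVec_sum]
      refine Finset.sum_congr rfl fun i _ => ?_
      rw [mulVec_smul, heig, smul_smul]
    rw [hM, hdot]
    have hc : ∃ i, c i ≠ 0 := by
      by_contra hno
      push Not at hno
      exact hne (by simp [hno])
    obtain ⟨i, hi⟩ := hc
    have hJ : ∀ i : J, Real.sqrt 2 - ε * hA.eigenvalues i < 0 := by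
      intro i
      have := (Finset.mem_filter.1 i.2).2
      linarith
    apply Finset.sum_neg'
    · intro j _
      nlinarith [hJ j, mul_self_nonneg (c j)]
    · refine ⟨i, Finset.mem_univ i, ?_⟩
      have : 0 < c i * c i := mul_self_pos.2 hi
      nlinarith [hJ i]

lemma roots_prod_X_sub {ι : Type*} [Fintype ι] (f : ι → ℝ) :
    (∏ i, (Polynomial.X - Polynomial.C (f i))).roots = Multiset.map f univ.val := by
  have h : (∏ i, (Polynomial.X - Polynomial.C (f i)))
      = ((Multiset.map f univ.val).map fun a => Polynomial.X - Polynomial.C a).prod := by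
    rw [Multiset.map_map]
    rfl
  rw [h, Polynomial.roots_multiset_prod_X_sub_C]

lemma card_eigen (hA : (G.adjMatrix ℝ).IsHermitian) (μ : Fin (Fintype.card V) → ℝ)
    (hμ : G.IsEigenvalueSeq μ) (p : ℝ → Prop) [DecidablePred p] :
    (univ.filter fun i => p (μ i)).card = (univ.filter fun j => p (hA.eigenvalues j)).card := by
  have h1 : (G.adjMatrix ℝ).charpoly
      = ∏ i : Fin (Fintype.card V), (Polynomial.X - Polynomial.C (μ i)) := by
    rw [← hμ.2]
    congr!
  rw [hA.charpoly_eq] at h1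
  have h2 := congrArg Polynomial.roots h1
  have h3 : Multiset.map hA.eigenvalues univ.val = Multiset.map μ univ.val := by
    rw [← roots_prod_X_sub μ, ← h2]
    symm
    exact roots_prod_X_sub hA.eigenvalues
  have h4 := congrArg (Multiset.countP p) h3
  rw [Multiset.countP_map, Multiset.countP_map] at h4
  exact h4.symm

end spectral

end SubcubicMedian

/-- If `G` is a graph on `n ≥ 1` vertices with maximum degree at most 3
(a subcubic graph), then its median eigenvalues satisfy `-√2 ≤ λ_L ≤ λ_H ≤ √2`,
where `H = ⌊(n+1)/2⌋`, `L = ⌈(n+1)/2⌉` (0-indexed positions `(n-1)/2` and `n/2`);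
in particular `R(G) = max (|λ_H|, |λ_L|) ≤ √2`. -/
theorem subcubic_median_eigenvalues_le_sqrt_two
    {V : Type*} [Fintype V] [DecidableEq V] (G : SimpleGraph V) [DecidableRel G.Adj]
    (n : ℕ) (hn : n = Fintype.card V) (hn1 : 1 ≤ n)
    (hdeg : ∀ v : V, G.degree v ≤ 3)
    (μ : Fin (Fintype.card V) → ℝ) (hμ : G.IsEigenvalueSeq μ)
    (H L : Fin (Fintype.card V))
    (hH : (H : ℕ) = (n - 1) / 2) (hL : (L : ℕ) = n / 2) :
    -Real.sqrt 2 ≤ μ L ∧ μ L ≤ μ H ∧ μ H ≤ Real.sqrt 2 ∧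
      max |μ H| |μ L| ≤ Real.sqrt 2 := by
  classical
  subst hn
  have hne : Nonempty V := Fintype.card_pos_iff.1 hn1
  have hA : (G.adjMatrix ℝ).IsHermitian := by
    rw [Matrix.IsHermitian, Matrix.conjTranspose_eq_transpose_of_trivial]
    simp
  have hanti := hμ.1
  have hLH : μ L ≤ μ H := hanti (by rw [Fin.le_def]; omega)
  have hup : μ H ≤ Real.sqrt 2 := by
    by_contra hlt
    push Not at hlt
    refine SubcubicMedian.Bad.elim (G := G) (ε := 1) ?_ hdeg (by norm_num)
    apply SubcubicMedian.bad_of_card hA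
    rw [← SubcubicMedian.card_eigen hA μ hμ (fun x => Real.sqrt 2 < 1 * x)]
    calc (Fintype.card V + 1) / 2 = (Finset.Iic H).card := by rw [Fin.card_Iic]; omega
      _ ≤ _ := Finset.card_le_card fun i hi => by
        have := hanti (Finset.mem_Iic.1 hi)
        simp only [Finset.mem_filter, Finset.mem_univ, true_and]
        linarith
  have hlo : -Real.sqrt 2 ≤ μ L := by
    by_contra hlt
    push Not at hlt
    refine SubcubicMedian.Bad.elim (G := G) (ε := -1) ?_ hdeg (by norm_num)
    apply SubcubicMedian.bad_of_card hA
    rw [← SubcubicMedian.card_eigen hA μ hμ (fun x => Real.sqrt 2 < -1 * x)]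
    calc (Fintype.card V + 1) / 2 = (Finset.Ici L).card := by rw [Fin.card_Ici]; omega
      _ ≤ _ := Finset.card_le_card fun i hi => by
        have := hanti (Finset.mem_Ici.1 hi)
        simp only [Finset.mem_filter, Finset.mem_univ, true_and]
        linarith
  refine ⟨hlo, hLH, hup, max_le (abs_le.2 ⟨?_, hup⟩) (abs_le.2 ⟨hlo, ?_⟩)⟩ <;> linarith
end

section
/- Let G be a subcubic graph (maximum degree at most 3) and let {A, B} be a nice partition of V(G) such that every connected component of G[B] has at most one edge. If a vertex v ∈ A has at most one neighbor in B, then {A∖{v}, B∪{v}} is also a nice partition of V(G). -/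
/-- Every connected component of the subgraph of `G` induced on `A` is a path on at
most 3 vertices (i.e. a path of length at most 2). -/
def SimpleGraph.IsNiceSide {V : Type*} (G : SimpleGraph V) (A : Set V) : Prop :=
  ∀ c : (G.induce A).ConnectedComponent,
    ∃ m : ℕ, m ≤ 3 ∧ Nonempty ((G.induce A).induce c.supp ≃g SimpleGraph.pathGraph m)

/-- `{A, B}` is a nice partition of `V(G)`: it is a partition of the vertex set and
every connected component of each of the induced subgraphs `G[A]`, `G[B]` is a path
on at most 3 vertices. -/
def SimpleGraph.IsNicePartition {V : Type*} (G : SimpleGraph V) (A B : Set V) : Prop :=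
  A ∪ B = Set.univ ∧ A ∩ B = ∅ ∧ G.IsNiceSide A ∧ G.IsNiceSide B

namespace NiceAux

variable {W : Type*}

/-- Local description of disjoint unions of paths on at most three vertices. -/
def Loc (H : SimpleGraph W) : Prop :=
  (∀ a b c, H.Adj a b → H.Adj b c → ¬ H.Adj a c) ∧
  (∀ a b c d, H.Adj a b → H.Adj b c → H.Adj c d → a ≠ c → b ≠ d → a ≠ d → False) ∧
  (∀ x a b c, H.Adj x a → H.Adj x b → H.Adj x c → a ≠ b → b ≠ c → a ≠ c → False)

def AllPaths (H : SimpleGraph W) : Prop :=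
  ∀ c : H.ConnectedComponent,
    ∃ m : ℕ, m ≤ 3 ∧ Nonempty (H.induce c.supp ≃g SimpleGraph.pathGraph m)

theorem loc_path (m : ℕ) (hm : m ≤ 3) : Loc (SimpleGraph.pathGraph m) := by
  refine ⟨?_, ?_, ?_⟩
  · intro a b c
    simp only [SimpleGraph.pathGraph_adj]
    omega
  · intro a b c d
    simp only [SimpleGraph.pathGraph_adj, ne_eq, Fin.ext_iff]
    omega
  · intro x a b c
    simp only [SimpleGraph.pathGraph_adj, ne_eq, Fin.ext_iff]
    omega

theorem loc_of_embedding {W' : Type*} {H : SimpleGraph W} {K : SimpleGraph W'}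
    (e : H ↪g K) (h : Loc K) : Loc H := by
  obtain ⟨h1, h2, h3⟩ := h
  refine ⟨?_, ?_, ?_⟩
  · intro a b c hab hbc hac
    exact h1 _ _ _ (e.map_adj_iff.2 hab) (e.map_adj_iff.2 hbc) (e.map_adj_iff.2 hac)
  · intro a b c d hab hbc hcd n1 n2 n3
    exact h2 _ _ _ _ (e.map_adj_iff.2 hab) (e.map_adj_iff.2 hbc) (e.map_adj_iff.2 hcd)
      (e.injective.ne n1) (e.injective.ne n2) (e.injective.ne n3)
  · intro x a b c hab hbc hcd n1 n2 n3
    exact h3 _ _ _ _ (e.map_adj_iff.2 hab) (e.map_adj_iff.2 hbc) (e.map_adj_iff.2 hcd)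
      (e.injective.ne n1) (e.injective.ne n2) (e.injective.ne n3)

theorem mem_of_adj {H : SimpleGraph W} {c : H.ConnectedComponent} {a b : W}
    (ha : a ∈ c.supp) (h : H.Adj a b) : b ∈ c.supp := by
  rw [SimpleGraph.ConnectedComponent.mem_supp_iff] at *
  rw [← ha]
  exact (SimpleGraph.ConnectedComponent.sound h.reachable).symm

theorem loc_of_allPaths {H : SimpleGraph W} (h : AllPaths H) : Loc H := by
  have key : ∀ c : H.ConnectedComponent, Loc (H.induce c.supp) := by
    intro c
    obtain ⟨m, hm, ⟨e⟩⟩ := h c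
    exact loc_of_embedding e.toEmbedding (loc_path m hm)
  have hs : ∀ a, a ∈ (H.connectedComponentMk a).supp := fun a => rfl
  refine ⟨?_, ?_, ?_⟩
  · intro a b c hab hbc hac
    have hb := mem_of_adj (hs a) hab
    have hc := mem_of_adj hb hbc
    exact (key (H.connectedComponentMk a)).1 ⟨a, hs a⟩ ⟨b, hb⟩ ⟨c, hc⟩ hab hbc hac
  · intro a b c d hab hbc hcd n1 n2 n3
    have hb := mem_of_adj (hs a) hab
    have hc := mem_of_adj hb hbc
    have hd := mem_of_adj hc hcd
    exact (key (H.connectedComponentMk a)).2.1 ⟨a, hs a⟩ ⟨b, hb⟩ ⟨c, hc⟩ ⟨d, hd⟩ hab hbc hcd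
      (by simpa using n1) (by simpa using n2) (by simpa using n3)
  · intro x a b c ha hb hc n1 n2 n3
    exact (key (H.connectedComponentMk x)).2.2 ⟨x, hs x⟩ ⟨a, mem_of_adj (hs x) ha⟩
      ⟨b, mem_of_adj (hs x) hb⟩ ⟨c, mem_of_adj (hs x) hc⟩ ha hb hc
      (by simpa using n1) (by simpa using n2) (by simpa using n3)

theorem iso_of_fun {H : SimpleGraph W} {n : ℕ} (f : Fin (n + 1) → W)
    (hinj : Function.Injective f)
    (hadj : ∀ i j, H.Adj (f i) (f j) ↔ (SimpleGraph.pathGraph (n + 1)).Adj i j)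
    (hcl : ∀ i w, H.Adj (f i) w → ∃ j, f j = w)
    (c : H.ConnectedComponent) (i : Fin (n + 1)) (hi : f i ∈ c.supp) :
    Nonempty (H.induce c.supp ≃g SimpleGraph.pathGraph (n + 1)) := by
  let φ : SimpleGraph.pathGraph (n + 1) →g H := ⟨f, fun {a b} h => (hadj a b).2 h⟩
  have hmem : ∀ j, f j ∈ c.supp := by
    intro j
    have h := ((SimpleGraph.pathGraph_connected n).preconnected j i).map φ
    rw [SimpleGraph.ConnectedComponent.mem_supp_iff] at *
    rw [← hi]
    exact SimpleGraph.ConnectedComponent.sound h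
  have hsub : ∀ w ∈ c.supp, ∃ j, f j = w := by
    intro w hw
    rw [SimpleGraph.ConnectedComponent.mem_supp_iff] at *
    have hr : H.Reachable (f i) w := SimpleGraph.ConnectedComponent.exact (hi.trans hw.symm)
    rw [SimpleGraph.reachable_iff_reflTransGen] at hr
    induction hr with
    | refl => exact ⟨i, rfl⟩
    | tail h1 h2 ih =>
      have : H.connectedComponentMk _ = c :=
        (SimpleGraph.ConnectedComponent.sound h2.reachable).trans hw
      obtain ⟨j, rfl⟩ := ih this
      exact hcl j _ h2
  let g : Fin (n + 1) → c.supp := fun j => ⟨f j, hmem j⟩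
  have hg : Function.Bijective g := by
    constructor
    · intro a b h
      exact hinj (congrArg Subtype.val h)
    · rintro ⟨w, hw⟩
      obtain ⟨j, hj⟩ := hsub w hw
      exact ⟨j, Subtype.ext hj⟩
  let e : SimpleGraph.pathGraph (n + 1) ≃g H.induce c.supp :=
    ⟨Equiv.ofBijective g hg, fun {a b} => hadj a b⟩
  exact ⟨e.symm⟩

set_option maxHeartbeats 1000000 in
theorem allPaths_of_loc {H : SimpleGraph W} (h : Loc H) : AllPaths H := by
  obtain ⟨h1, h2, h3⟩ := h
  intro c
  have three : ∀ a b d, H.Adj a b → H.Adj b d → a ≠ d → b ∈ c.supp →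
      ∃ m : ℕ, m ≤ 3 ∧ Nonempty (H.induce c.supp ≃g SimpleGraph.pathGraph m) := by
    intro a b d hab hbd had hb
    have nad := h1 a b d hab hbd
    refine ⟨3, le_rfl, iso_of_fun ![a, b, d] ?_ ?_ ?_ c 1 hb⟩
    · have := hab.ne
      have := hbd.ne
      clear h1 h2 h3
      intro i j hij
      fin_cases i <;> fin_cases j <;> simp_all
    · have hba := hab.symm
      have hdb := hbd.symm
      have nda : ¬ H.Adj d a := fun h => nad h.symm
      intro i j
      fin_cases i <;> fin_cases j <;>
        simp [SimpleGraph.pathGraph_adj, hab, hba, hbd, hdb, nad, nda]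
    · intro i w hw
      by_contra hne
      push Not at hne
      have e0 : a ≠ w := hne 0
      have e1 : b ≠ w := hne 1
      have e2 : d ≠ w := hne 2
      fin_cases i
      · exact h2 w a b d hw.symm hab hbd e1.symm had e2.symm
      · exact h3 b a d w hab.symm hbd hw had e2 e0
      · exact h2 w d b a hw.symm hbd.symm hab.symm e1.symm had.symm e0.symm
  obtain ⟨x, rfl⟩ := c.exists_rep
  set c : H.ConnectedComponent := Quot.mk _ x with hc
  have hx : x ∈ c.supp := rfl
  by_cases hy : ∃ y, H.Adj x y
  · obtain ⟨y, hxy⟩ := hy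
    have hyc := mem_of_adj hx hxy
    by_cases hz : ∃ z, H.Adj x z ∧ z ≠ y
    · obtain ⟨z, hxz, hzy⟩ := hz
      exact three z x y hxz.symm hxy hzy hx
    by_cases hw : ∃ z, H.Adj y z ∧ z ≠ x
    · obtain ⟨z, hyz, hzx⟩ := hw
      exact three x y z hxy hyz hzx.symm hyc
    push Not at hz hw
    refine ⟨2, by norm_num, iso_of_fun ![x, y] ?_ ?_ ?_ c 0 hx⟩
    · have hne := hxy.ne
      have hne' := hne.symm
      intro i j hij
      fin_cases i <;> fin_cases j <;> simp [hne, hne'] at hij ⊢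
    · have hyx := hxy.symm
      intro i j
      fin_cases i <;> fin_cases j <;> simp [SimpleGraph.pathGraph_adj, hxy, hyx]
    · intro i w h
      fin_cases i
      · exact ⟨1, (hz w h).symm⟩
      · exact ⟨0, (hw w h).symm⟩
  · push Not at hy
    refine ⟨1, by norm_num, iso_of_fun ![x] ?_ ?_ ?_ c 0 hx⟩
    · intro i j hij
      exact Fin.ext (by omega)
    · intro i j
      fin_cases i; fin_cases j; simp
    · intro i w h
      fin_cases i
      exact absurd h (hy w)

end NiceAux

/-- Let `G` be a subcubic graph and `{A, B}` a nice partition such that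
every connected component of `G[B]` has at most one edge.  If `v ∈ A` has at most
one neighbor in `B`, then `{A \ {v}, B ∪ {v}}` is also a nice partition (i.e. `v` is
unstable). -/
theorem unstable_vertex_of_nice_partition
    {V : Type*} [Fintype V] [DecidableEq V] (G : SimpleGraph V) [DecidableRel G.Adj]
    (hdeg : ∀ v : V, G.degree v ≤ 3)
    (A B : Set V) (hnice : G.IsNicePartition A B)
    (hBedges : ∀ c : (G.induce B).ConnectedComponent,
      ((G.induce B).induce c.supp).edgeSet.ncard ≤ 1)
    (v : V) (hv : v ∈ A)
    (hvB : {u ∈ B | G.Adj v u}.ncard ≤ 1) :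
    G.IsNicePartition (A \ {v}) (B ∪ {v}) := by
  obtain ⟨hU, hI, hA, hB⟩ := hnice
  have hLA := NiceAux.loc_of_allPaths (H := G.induce A) hA
  have hLB := NiceAux.loc_of_allPaths (H := G.induce B) hB
  have noP3 : ∀ a b c, a ∈ B → b ∈ B → c ∈ B → G.Adj a b → G.Adj b c → a = c := by
    intro a b c ha hb hc hab hbc
    have sb : (⟨b, hb⟩ : B) ∈ ((G.induce B).connectedComponentMk ⟨b, hb⟩).supp := rfl
    have hba : (G.induce B).Adj ⟨b, hb⟩ ⟨a, ha⟩ := hab.symm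
    have hbc' : (G.induce B).Adj ⟨b, hb⟩ ⟨c, hc⟩ := hbc
    have sa := NiceAux.mem_of_adj sb hba
    have sc := NiceAux.mem_of_adj sb hbc'
    have := (Set.ncard_le_one (Set.toFinite _)).1
      (hBedges ((G.induce B).connectedComponentMk ⟨b, hb⟩))
      s(⟨⟨b, hb⟩, sb⟩, ⟨⟨a, ha⟩, sa⟩) hba s(⟨⟨b, hb⟩, sb⟩, ⟨⟨c, hc⟩, sc⟩) hbc'
    have h2 := Sym2.congr_right.1 this
    simpa using h2
  have one : ∀ a b, a ∈ B → b ∈ B → G.Adj v a → G.Adj v b → a = b := by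
    intro a b ha hb h1 h2
    exact (Set.ncard_le_one (Set.toFinite _)).1 hvB a ⟨ha, h1⟩ b ⟨hb, h2⟩
  refine ⟨?_, ?_, ?_, ?_⟩
  · ext x
    have : x ∈ A ∪ B := hU ▸ Set.mem_univ x
    simp only [Set.mem_union, Set.mem_sdiff, Set.mem_singleton_iff, Set.mem_univ] at *
    tauto
  · ext x
    have : x ∉ A ∩ B := by rw [hI]; exact Set.notMem_empty x
    simp only [Set.mem_union, Set.mem_inter_iff, Set.mem_sdiff, Set.mem_singleton_iff,
      Set.mem_empty_iff_false] at *
    tauto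
  · exact NiceAux.allPaths_of_loc
      (NiceAux.loc_of_embedding (SimpleGraph.induceHomOfLE G Set.sdiff_subset) hLA)
  · apply NiceAux.allPaths_of_loc
    have hm : ∀ x : ↥(B ∪ {v}), (x : V) ∈ B ∨ (x : V) = v := fun x => x.2
    have sy : ∀ a b, G.Adj a b → G.Adj b a := fun a b h => h.symm
    have ir : ∀ a, ¬ G.Adj a a := fun a h => h.ne rfl
    refine ⟨?_, ?_, ?_⟩
    · intro a b c hab hbc hac
      have := hm a
      have := hm b
      have := hm c
      simp only [SimpleGraph.comap_adj, Function.Embedding.subtype_apply] at hab hbc hac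
      grind
    · intro a b c d hab hbc hcd n1 n2 n3
      have := hm a
      have := hm b
      have := hm c
      have := hm d
      simp only [SimpleGraph.comap_adj, Function.Embedding.subtype_apply, ne_eq, Subtype.ext_iff] at *
      grind
    · intro x a b c hab hbc hcd n1 n2 n3
      have := hm a
      have := hm b
      have := hm c
      have := hm x
      simp only [SimpleGraph.comap_adj, Function.Embedding.subtype_apply, ne_eq, Subtype.ext_iff] at *
      grind
end
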